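/- arXiv:1903.06363 — 3 statements merged into one kernel-verified Lean document; each statement's English description precedes it below -/
import Mathlib

section
/- Let R be a Hecke symmetry on a finite dimensional vector space V, i.e. R satisfies the braid relation and (R + id)(R - q·id) = 0 with q ≠ 0. Define the R-skewsymmetric algebra Λ(V,R) = T(V)/I where I is the ideal generated by Ker(R - q·id) ⊆ V⊗V. If Λ_n(V,R) ≠ 0 for some n > 1, then every nonzero element a ∈ Λ_1(V,R) satisfies a·Λ_{n-1}(V,R) ≠ 0 and Λ_{n-1}(V,R)·a ≠ 0. -/
noncomputable section
open TensorProduct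

variable (k : Type) [Field k] (V : Type) [AddCommGroup V] [Module k V]

/-- `TP k V m` : the `(m+1)`-st tensor power of `V` as a bundled module. -/
def TP : ℕ → ModuleCat k
  | 0 => ModuleCat.of k V
  | m + 1 => ModuleCat.of k (V ⊗[k] (TP m))

/-- `TpowPos k V m` is the `(m+1)`-st tensor power of `V`. -/
abbrev TpowPos (m : ℕ) : Type := TP k V m

/-- `Tpow k V m` is the `m`-th tensor power of `V` (with `Tpow 0 = k`). -/
def Tpow : ℕ → Type
  | 0 => k
  | m + 1 => TpowPos k V m

instance : (m : ℕ) → AddCommGroup (Tpow k V m)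
  | 0 => inferInstanceAs (AddCommGroup k)
  | m + 1 => inferInstanceAs (AddCommGroup (TpowPos k V m))

instance : (m : ℕ) → Module k (Tpow k V m)
  | 0 => inferInstanceAs (Module k k)
  | m + 1 => inferInstanceAs (Module k (TpowPos k V m))

variable (R : V ⊗[k] V →ₗ[k] V ⊗[k] V)

/-- The operator `R_j` acting on the `(p+1)`-st tensor power `TpowPos k V p`,
applying `R` to the tensor factors `j+1, j+2` (junk `id` when out of range). -/
def RopP : (j p : ℕ) → TpowPos k V p →ₗ[k] TpowPos k V p
  | 0, 0 => LinearMap.id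
  | 0, 1 => R
  | 0, s + 2 =>
      (TensorProduct.assoc k V V (TpowPos k V s)).toLinearMap ∘ₗ
        (R.rTensor (TpowPos k V s)) ∘ₗ
          (TensorProduct.assoc k V V (TpowPos k V s)).symm.toLinearMap
  | _ + 1, 0 => LinearMap.id
  | j + 1, p + 1 => LinearMap.lTensor V (RopP j p)

/-- The operator `R_j` on the `n`-th tensor power `Tpow k V n`. -/
def RopT (j : ℕ) : (n : ℕ) → Tpow k V n →ₗ[k] Tpow k V n
  | 0 => LinearMap.id
  | m + 1 => RopP k V R j m

/-- Cast along an equality of indices. -/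
def castP {a b : ℕ} (h : a = b) : TpowPos k V a →ₗ[k] TpowPos k V b := by
  subst h; exact LinearMap.id

/-- Cast along an equality of indices. -/
def castT {a b : ℕ} (h : a = b) : Tpow k V a →ₗ[k] Tpow k V b := by
  subst h; exact LinearMap.id

/-- Appending a vector on the right: `TpowPos m ⊗ V → TpowPos (m+1)`. -/
def rmulAux : (m : ℕ) → TpowPos k V m ⊗[k] V →ₗ[k] TpowPos k V (m + 1)
  | 0 => LinearMap.id
  | m + 1 =>
      (LinearMap.lTensor V (rmulAux m)) ∘ₗ
        (TensorProduct.assoc k V (TpowPos k V m) V).toLinearMap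

/-- Concatenation `TpowPos p ⊗ TpowPos r → TpowPos (p + r + 1)` of tensors. -/
def mulAux : (r p : ℕ) → TpowPos k V p ⊗[k] TpowPos k V r →ₗ[k] TpowPos k V (p + r + 1)
  | 0, p => rmulAux k V p
  | s + 1, p =>
      castP k V (show (p + 1) + s + 1 = p + (s + 1) + 1 by omega) ∘ₗ (mulAux s (p + 1)) ∘ₗ
        (LinearMap.rTensor (TpowPos k V s) (rmulAux k V p)) ∘ₗ
          (TensorProduct.assoc k (TpowPos k V p) V (TpowPos k V s)).symm.toLinearMap

/-- The multiplication `Tpow p ⊗ Tpow r → Tpow (p + r)` of the tensor algebra. -/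
def mulT : (p r : ℕ) → Tpow k V p ⊗[k] Tpow k V r →ₗ[k] Tpow k V (p + r)
  | 0, r => castT k V (show r = 0 + r by omega) ∘ₗ (TensorProduct.lid k (Tpow k V r)).toLinearMap
  | p + 1, 0 => (TensorProduct.rid k (Tpow k V (p + 1))).toLinearMap
  | p + 1, r + 1 => castT k V (show p + r + 1 + 1 = (p + 1) + (r + 1) by omega) ∘ₗ mulAux k V r p

/-- The degree-`n` component of the ideal of relations of `Λ(V,R)`:
`I_n = Σ_i Ker(R_i - q)` inside the `n`-th tensor power. -/
def Isub (q : k) (n : ℕ) : Submodule k (Tpow k V n) :=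
  ⨆ (i : ℕ) (_ : i + 2 ≤ n), LinearMap.ker (RopT k V R i n - q • LinearMap.id)


/-- `R` satisfies the braid relation `R₁R₂R₁ = R₂R₁R₂` on `V^{⊗3}`. -/
def SatisfiesBraid : Prop :=
  RopP k V R 0 2 ∘ₗ RopP k V R 1 2 ∘ₗ RopP k V R 0 2 =
    RopP k V R 1 2 ∘ₗ RopP k V R 0 2 ∘ₗ RopP k V R 1 2

/-- `R` satisfies the Hecke relation `(R + id)(R - q·id) = 0`. -/
def SatisfiesHecke (q : k) : Prop :=
  (R + LinearMap.id) ∘ₗ (R - q • LinearMap.id) = 0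


/-- One-sided abstract data: left insertion `L`, right insertion `S`, left contraction `C`,
braid operators `T i n` on `E n`. -/
structure BData (q : k) (E : ℕ → Type) [∀ n, AddCommGroup (E n)] [∀ n, Module k (E n)] where
  L : ∀ n, V →ₗ[k] E n →ₗ[k] E (n + 1)
  S : ∀ n, V →ₗ[k] E n →ₗ[k] E (n + 1)
  C : ∀ n, (V →ₗ[k] k) → E (n + 1) →ₗ[k] E n
  T : ℕ → ∀ n, E n →ₗ[k] E n
  comm : ∀ n a b s, L (n + 1) a (S n b s) = S (n + 1) b (L n a s)
  TL : ∀ i n a s, i + 2 ≤ n → T (i + 1) (n + 1) (L n a s) = L n a (T i n s)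
  TS : ∀ i n a s, i + 2 ≤ n → T i (n + 1) (S n a s) = S n a (T i n s)
  spanL : ∀ n (p : Submodule k (E (n + 1))), (∀ a s, L n a s ∈ p) → p = ⊤
  spanS : ∀ n (p : Submodule k (E (n + 1))), (∀ a s, S n a s ∈ p) → p = ⊤
  CL : ∀ n φ a s, C n φ (L n a s) = φ a • s
  CT : ∀ φ a v, ∃ w, ∀ n s, C (n + 1) φ (T 0 (n + 2) (L (n + 1) a (L n v s))) = L n w s
  surj : ∀ i n, i + 2 ≤ n → Function.Surjective (T i n)
  braid : ∀ i n x, i + 3 ≤ n →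
    T i n (T (i + 1) n (T i n x)) = T (i + 1) n (T i n (T (i + 1) n x))
  far : ∀ i j n x, i + 2 ≤ j → j + 2 ≤ n → T i n (T j n x) = T j n (T i n x)

namespace BData

variable {k V}
variable {q : k} {E : ℕ → Type} [∀ n, AddCommGroup (E n)] [∀ n, Module k (E n)]
variable (D : BData k V q E)

/-- The relations in degree `n`. -/
def I (n : ℕ) : Submodule k (E n) :=
  ⨆ (i : ℕ) (_ : i + 2 ≤ n), LinearMap.ker (D.T i n - q • LinearMap.id)

/-- `T 0 ∘ ... ∘ T (j-1)`. -/
def P (n : ℕ) : ℕ → E n →ₗ[k] E n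
  | 0 => LinearMap.id
  | j + 1 => P n j ∘ₗ D.T j n

theorem mem_I {n i : ℕ} (h : i + 2 ≤ n) {x : E n} (hx : D.T i n x = q • x) : x ∈ D.I n := by
  refine Submodule.mem_iSup_of_mem i (Submodule.mem_iSup_of_mem h ?_)
  simp [hx]

theorem I_le {n : ℕ} {p : Submodule k (E n)}
    (h : ∀ i x, i + 2 ≤ n → D.T i n x = q • x → x ∈ p) : D.I n ≤ p := by
  refine iSup_le fun i => iSup_le fun hi => fun x hx => h i x hi ?_
  simpa [sub_eq_zero] using hx

theorem P_comm (n i : ℕ) (hi : i + 2 ≤ n) (x : E n) :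
    ∀ j, j < i → D.T i n (D.P n j x) = D.P n j (D.T i n x) := by
  intro j
  induction j generalizing x with
  | zero => intro _; rfl
  | succ j ih =>
    intro h
    change D.T i n (D.P n j (D.T j n x)) = D.P n j (D.T j n (D.T i n x))
    rw [ih _ (by omega), D.far j i n x (by omega) hi]

theorem P_shift (n i : ℕ) (x : E n) :
    ∀ j, i + 2 ≤ j → j + 1 ≤ n → D.T (i + 1) n (D.P n j x) = D.P n j (D.T i n x) := by
  intro j h
  induction j, h using Nat.le_induction generalizing x with
  | base =>
    intro h
    change D.T (i + 1) n (D.P n i (D.T i n (D.T (i + 1) n x))) =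
      D.P n i (D.T i n (D.T (i + 1) n (D.T i n x)))
    rw [P_comm D n (i + 1) (by omega) _ i (by omega), D.braid i n x (by omega)]
  | succ j hj ih =>
    intro h
    change D.T (i + 1) n (D.P n j (D.T j n x)) = D.P n j (D.T j n (D.T i n x))
    rw [ih _ (by omega), D.far i j n x (by omega) (by omega)]

theorem P_L (n : ℕ) (a : V) (t : E n) :
    ∀ j, j + 1 ≤ n → D.P (n + 1) (j + 1) (D.L n a t) = D.T 0 (n + 1) (D.L n a (D.P n j t)) := by
  intro j
  induction j generalizing t with
  | zero => intro _; rfl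
  | succ j ih =>
    intro h
    change D.P (n + 1) (j + 1) (D.T (j + 1) (n + 1) (D.L n a t)) =
      D.T 0 (n + 1) (D.L n a (D.P n j (D.T j n t)))
    rw [D.TL j n a t (by omega), ih _ (by omega)]

theorem P_surj (n : ℕ) : ∀ j, j + 1 ≤ n → Function.Surjective (D.P n j) := by
  intro j
  induction j with
  | zero => intro _; exact Function.surjective_id
  | succ j ih =>
    intro h
    change Function.Surjective (⇑(D.P n j) ∘ ⇑(D.T j n))
    exact (ih (by omega)).comp (D.surj j n (by omega))

theorem C_T (n i : ℕ) (hi : i + 2 ≤ n) (φ : V →ₗ[k] k) (x : E (n + 1)) :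
    D.C n φ (D.T (i + 1) (n + 1) x) = D.T i n (D.C n φ x) := by
  have := D.spanL n (LinearMap.eqLocus (D.C n φ ∘ₗ D.T (i + 1) (n + 1)) (D.T i n ∘ₗ D.C n φ))
    (by intro a s; simp [LinearMap.mem_eqLocus, D.TL i n a s hi, D.CL])
  have h : x ∈ LinearMap.eqLocus (D.C n φ ∘ₗ D.T (i + 1) (n + 1)) (D.T i n ∘ₗ D.C n φ) := by
    rw [this]; trivial
  simpa using h

theorem C_mem (n i : ℕ) (hi : i + 2 ≤ n) (φ : V →ₗ[k] k) (x : E (n + 1))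
    (hx : D.T (i + 1) (n + 1) x = q • x) : D.C n φ x ∈ D.I n := by
  apply D.mem_I hi
  rw [← D.C_T n i hi, hx, map_smul]

/-- the annihilator -/
def Ann (n : ℕ) : Set V := {a | ∀ s, D.L n a s ∈ D.I (n + 1)}

theorem step1 (n : ℕ) (a : V) (ha : a ∈ D.Ann (n + 1)) (φ : V →ₗ[k] k) (t : E (n + 2)) :
    D.C (n + 2) φ (D.T 0 (n + 3) (D.L (n + 2) a t)) ∈ D.I (n + 2) := by
  obtain ⟨t', rfl⟩ := D.P_surj (n + 2) (n + 1) (by omega) t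
  rw [← D.P_L (n + 2) a t' (n + 1) (by omega)]
  have key : ∀ b s, s ∈ D.I (n + 2) →
      D.C (n + 2) φ (D.P (n + 3) (n + 2) (D.S (n + 2) b s)) ∈ D.I (n + 2) := by
    intro b s hs
    have : D.I (n + 2) ≤ (D.I (n + 2)).comap
        (D.C (n + 2) φ ∘ₗ D.P (n + 3) (n + 2) ∘ₗ D.S (n + 2) b) := by
      apply D.I_le
      intro i x hi hx
      refine D.C_mem (n + 2) i hi φ _ ?_
      simp only [LinearMap.comp_apply]
      rw [D.P_shift (n + 3) i _ (n + 2) (by omega) (by omega)]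
      rw [D.TS i (n + 2) b x hi, hx]
      simp
    exact this hs
  have := D.spanS (n + 1) ((D.I (n + 2)).comap
        (D.C (n + 2) φ ∘ₗ D.P (n + 3) (n + 2) ∘ₗ D.L (n + 2) a)) (by
      intro b s
      change D.C (n + 2) φ (D.P (n + 3) (n + 2) (D.L (n + 2) a (D.S (n + 1) b s))) ∈ D.I (n + 2)
      rw [D.comm]
      exact key b _ (ha s))
  have h : t' ∈ (D.I (n + 2)).comap
        (D.C (n + 2) φ ∘ₗ D.P (n + 3) (n + 2) ∘ₗ D.L (n + 2) a) := by rw [this]; trivial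
  exact h

theorem Z_mem (hq : q ≠ 0) (n : ℕ) (φ : V →ₗ[k] k) (x : E (n + 1)) (hx : x ∈ D.I (n + 1)) :
    ∑ j ∈ Finset.range (n + 1), (-q⁻¹) ^ j • D.C n φ (D.P (n + 1) j x) ∈ D.I n := by
  have : D.I (n + 1) ≤ (D.I n).comap
      (∑ j ∈ Finset.range (n + 1), (-q⁻¹) ^ j • (D.C n φ ∘ₗ D.P (n + 1) j)) := by
    apply D.I_le
    intro i x hi hx
    simp only [Submodule.mem_comap, LinearMap.sum_apply, LinearMap.smul_apply,
      LinearMap.comp_apply]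
    have h1 : i ∈ Finset.range (n + 1) := by simp; omega
    have h2 : i + 1 ∈ (Finset.range (n + 1)).erase i := by simp; omega
    rw [← Finset.add_sum_erase _ _ h1, ← Finset.add_sum_erase _ _ h2, ← add_assoc]
    have h0 : D.P (n + 1) (i + 1) x = q • D.P (n + 1) i x := by
      change D.P (n + 1) i (D.T i (n + 1) x) = _
      rw [hx, map_smul]
    have hz : (-q⁻¹) ^ i • D.C n φ (D.P (n + 1) i x)
        + (-q⁻¹) ^ (i + 1) • D.C n φ (D.P (n + 1) (i + 1) x) = 0 := by
      rw [h0, map_smul, smul_smul, ← add_smul]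
      have : (-q⁻¹) ^ i + (-q⁻¹) ^ (i + 1) * q = 0 := by
        rw [pow_succ]; field_simp; ring
      rw [this, zero_smul]
    rw [hz, zero_add]
    refine Submodule.sum_mem _ fun j hj => Submodule.smul_mem _ _ ?_
    simp only [Finset.mem_erase, Finset.mem_range] at hj
    rcases lt_or_ge j i with hji | hji
    · obtain ⟨i', rfl⟩ : ∃ i', i = i' + 1 := ⟨i - 1, by omega⟩
      refine D.C_mem n i' (by omega) φ _ ?_
      rw [D.P_comm _ _ hi _ _ hji, hx, map_smul]
    · refine D.C_mem n i (by omega) φ _ ?_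
      rw [D.P_shift _ i _ _ (by omega) (by omega), hx, map_smul]
  have h := this hx
  simpa using h

theorem main (hq : q ≠ 0) (n : ℕ) (a : V) (ha0 : a ≠ 0)
    (ha : ∀ s, D.L (n + 1) a s ∈ D.I (n + 2)) : D.I (n + 2) = ⊤ := by
  obtain ⟨φ, hφ⟩ : ∃ φ : V →ₗ[k] k, φ a = 1 := by
    obtain ⟨φ, hφ⟩ : ∃ φ : V →ₗ[k] k, φ a ≠ 0 := by
      by_contra! h
      exact ha0 ((Module.forall_dual_apply_eq_zero_iff k a).1 h)
    exact ⟨(φ a)⁻¹ • φ, by simp [hφ]⟩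
  -- every `s` lies in `I + A E`
  have hT : ∀ b t, D.S (n + 1) b (D.C (n + 1) φ (D.T 0 (n + 2) (D.L (n + 1) a t))) ∈
      D.I (n + 2) := by
    intro b t
    have := D.spanL n ((D.I (n + 2)).comap (D.S (n + 1) b ∘ₗ D.C (n + 1) φ ∘ₗ D.T 0 (n + 2) ∘ₗ
      D.L (n + 1) a)) (by
        intro v s
        change D.S (n + 1) b (D.C (n + 1) φ (D.T 0 (n + 2) (D.L (n + 1) a (D.L n v s)))) ∈
          D.I (n + 2)
        obtain ⟨w, hw⟩ := D.CT φ a v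
        rw [hw, ← D.comm, ← hw]
        exact D.step1 n a ha φ _)
    have h : t ∈ ((D.I (n + 2)).comap (D.S (n + 1) b ∘ₗ D.C (n + 1) φ ∘ₗ D.T 0 (n + 2) ∘ₗ
      D.L (n + 1) a)) := by rw [this]; trivial
    exact h
  have hI : ∀ b x, x ∈ D.I (n + 1) → D.S (n + 1) b x ∈ D.I (n + 2) := by
    intro b x hx
    have : D.I (n + 1) ≤ (D.I (n + 2)).comap (D.S (n + 1) b) := by
      apply D.I_le
      intro i x hi hx
      refine D.mem_I (i := i) (by omega) ?_
      rw [D.TS i _ b x hi, hx, map_smul]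
    exact this hx
  apply D.spanS
  intro b s
  have hz := hI b _ (D.Z_mem hq (n + 1) φ _ (ha s))
  rw [Finset.sum_range_succ', map_add, map_sum] at hz
  rw [Submodule.add_mem_iff_right] at hz
  · change D.S (n + 1) b ((-q⁻¹) ^ 0 • D.C (n + 1) φ (D.L (n + 1) a s)) ∈ _ at hz
    rw [D.CL, hφ] at hz
    simpa using hz
  · refine Submodule.sum_mem _ fun j hj => ?_
    rw [map_smul]
    refine Submodule.smul_mem _ _ ?_
    rw [Finset.mem_range] at hj
    rw [D.P_L (n + 1) a s j (by omega)]
    exact hT b _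

end BData


/-- Left insertion of a vector. -/
def Lm : ∀ n, V →ₗ[k] Tpow k V n →ₗ[k] Tpow k V (n + 1)
  | 0 => (LinearMap.lsmul k V).flip
  | n + 1 => TensorProduct.mk k V (TpowPos k V n)

/-- Right insertion of a vector. -/
def Sm : ∀ n, V →ₗ[k] Tpow k V n →ₗ[k] Tpow k V (n + 1)
  | 0 => (LinearMap.lsmul k V).flip
  | n + 1 => (TensorProduct.curry (rmulAux k V n)).flip

/-- Left contraction. -/
def Cl (φ : V →ₗ[k] k) : ∀ n, Tpow k V (n + 1) →ₗ[k] Tpow k V n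
  | 0 => φ
  | n + 1 => (TensorProduct.lid k (TpowPos k V n)).toLinearMap ∘ₗ LinearMap.rTensor (TpowPos k V n) φ

/-- Right contraction. -/
def Cr (φ : V →ₗ[k] k) : ∀ n, Tpow k V (n + 1) →ₗ[k] Tpow k V n
  | 0 => φ
  | 1 => (TensorProduct.rid k V).toLinearMap ∘ₗ LinearMap.lTensor V φ
  | n + 2 => LinearMap.lTensor V (Cr φ (n + 1))

theorem Lm_span : ∀ n (p : Submodule k (Tpow k V (n + 1))), (∀ a s, Lm k V n a s ∈ p) → p = ⊤
  | 0, p, h => by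
    rw [eq_top_iff]
    intro x _
    have := h x (1 : k)
    change (1 : k) • (show V from x) ∈ p at this
    rwa [one_smul] at this
  | n + 1, p, h => by
    rw [eq_top_iff]
    intro x _
    change V ⊗[k] TpowPos k V n at x
    induction x using TensorProduct.induction_on with
    | zero => exact p.zero_mem
    | tmul a s => exact h a s
    | add x y hx hy => exact p.add_mem (hx trivial) (hy trivial)

theorem Lm_ext {M : Type} [AddCommGroup M] [Module k M] {n : ℕ} {f g : Tpow k V (n + 1) →ₗ[k] M}
    (h : ∀ a s, f (Lm k V n a s) = g (Lm k V n a s)) (x) : f x = g x := by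
  have := Lm_span k V n (LinearMap.eqLocus f g) h
  have h : x ∈ LinearMap.eqLocus f g := by rw [this]; trivial
  exact h

theorem LS_comm : ∀ n a b s,
    Lm k V (n + 1) a (Sm k V n b s) = Sm k V (n + 1) b (Lm k V n a s)
  | 0, a, b, s => by
    change a ⊗ₜ[k] ((show k from s) • b) = ((show k from s) • a) ⊗ₜ[k] b
    rw [TensorProduct.smul_tmul]
  | n + 1, a, b, s => rfl

theorem Sm_span : ∀ n (p : Submodule k (Tpow k V (n + 1))), (∀ a s, Sm k V n a s ∈ p) → p = ⊤
  | 0, p, h => Lm_span k V 0 p h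
  | n + 1, p, h => by
    apply Lm_span
    intro a s
    have := Sm_span n (p.comap (Lm k V (n + 1) a)) (by
      intro b s
      rw [Submodule.mem_comap, LS_comm]
      exact h _ _)
    have h : s ∈ p.comap (Lm k V (n + 1) a) := by rw [this]; trivial
    exact h

theorem Sm_ext {M : Type} [AddCommGroup M] [Module k M] {n : ℕ} {f g : Tpow k V (n + 1) →ₗ[k] M}
    (h : ∀ a s, f (Sm k V n a s) = g (Sm k V n a s)) (x) : f x = g x := by
  have := Sm_span k V n (LinearMap.eqLocus f g) h
  have h : x ∈ LinearMap.eqLocus f g := by rw [this]; trivial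
  exact h

theorem Cl_Lm (φ : V →ₗ[k] k) : ∀ n a s, Cl k V φ n (Lm k V n a s) = φ a • s
  | 0, a, s => by
    change φ ((show k from s) • a) = φ a * (show k from s)
    rw [map_smul, smul_eq_mul, mul_comm]
  | n + 1, a, s => rfl

theorem Cr_Lm (φ : V →ₗ[k] k) : ∀ n a s,
    Cr k V φ (n + 1) (Lm k V (n + 1) a s) = Lm k V n a (Cr k V φ n s)
  | 0, a, s => rfl
  | n + 1, a, s => rfl

theorem Cr_Sm (φ : V →ₗ[k] k) : ∀ n a s, Cr k V φ n (Sm k V n a s) = φ a • s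
  | 0, a, s => Cl_Lm k V φ 0 a s
  | n + 1, a, s => by
    refine Lm_ext k V (f := Cr k V φ (n + 1) ∘ₗ Sm k V (n + 1) a) (g := φ a • LinearMap.id) ?_ s
    intro b s
    simp only [LinearMap.comp_apply, LinearMap.smul_apply, LinearMap.id_apply]
    rw [← LS_comm, Cr_Lm, Cr_Sm φ n, map_smul]

theorem Cl_Sm (φ : V →ₗ[k] k) (n : ℕ) (a) (s) :
    Cl k V φ (n + 1) (Sm k V (n + 1) a s) = Sm k V n a (Cl k V φ n s) := by
  refine Lm_ext k V (f := Cl k V φ (n + 1) ∘ₗ Sm k V (n + 1) a)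
    (g := Sm k V n a ∘ₗ Cl k V φ n) ?_ s
  intro b s
  simp only [LinearMap.comp_apply]
  rw [← LS_comm, Cl_Lm, Cl_Lm, map_smul]

theorem T_Lm (i : ℕ) : ∀ n a s, i + 2 ≤ n →
    RopT k V R (i + 1) (n + 1) (Lm k V n a s) = Lm k V n a (RopT k V R i n s)
  | 0, _, _, h => by omega
  | n + 1, a, s, _ => rfl

/-- Two-fold left insertion. -/
def LL : ∀ n, V ⊗[k] V →ₗ[k] Tpow k V n →ₗ[k] Tpow k V (n + 2)
  | n => TensorProduct.lift
    { toFun := fun a => { toFun := fun b => Lm k V (n + 1) a ∘ₗ Lm k V n b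
                          map_add' := by intros; ext; simp
                          map_smul' := by intros; ext; simp }
      map_add' := by intros; ext; simp
      map_smul' := by intros; ext; simp }

theorem LL_tmul (n a b s) : LL k V n (a ⊗ₜ b) s = Lm k V (n + 1) a (Lm k V n b s) := rfl

theorem T_LL : ∀ n x s, RopT k V R 0 (n + 2) (LL k V n x s) = LL k V n (R x) s
  | 0, x, s => by
    have h : ∀ x, LL k V 0 x s = (show k from s) • (show Tpow k V 2 from x) := by
      intro x
      induction x using TensorProduct.induction_on with
      | zero => simp; rfl
      | tmul a b =>
        rw [LL_tmul]
        change a ⊗ₜ[k] ((show k from s) • b) = (show k from s) • (a ⊗ₜ[k] b)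
        rw [TensorProduct.tmul_smul]
      | add x y hx hy => 
        rw [map_add, LinearMap.add_apply, hx, hy, ← smul_add]; rfl
    rw [h, h, map_smul]; rfl
  | n + 1, x, s => by
    have h : ∀ x, LL k V (n + 1) x s =
        (TensorProduct.assoc k V V (TpowPos k V n)) (x ⊗ₜ[k] (show TpowPos k V n from s)) := by
      intro x
      induction x using TensorProduct.induction_on with
      | zero => simp; rfl
      | tmul a b => rfl
      | add x y hx hy =>
        rw [map_add, LinearMap.add_apply, hx, hy, TensorProduct.add_tmul, map_add]; rfl
    rw [h, h]
    change (TensorProduct.assoc k V V (TpowPos k V n)) (R.rTensor (TpowPos k V n)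
      ((TensorProduct.assoc k V V (TpowPos k V n)).symm _)) = _
    rw [LinearEquiv.symm_apply_apply]; rfl

theorem LL_ext {M : Type} [AddCommGroup M] [Module k M] {n : ℕ} {f g : Tpow k V (n + 2) →ₗ[k] M}
    (h : ∀ x s, f (LL k V n x s) = g (LL k V n x s)) (x) : f x = g x := by
  refine Lm_ext k V (fun a s => ?_) x
  refine Lm_ext k V (f := f ∘ₗ Lm k V (n + 1) a) (g := g ∘ₗ Lm k V (n + 1) a) (fun b s => ?_) s
  exact h (a ⊗ₜ b) s

theorem LL_comm {n m : ℕ} (f : Tpow k V n →ₗ[k] Tpow k V m)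
    (F : Tpow k V (n + 2) →ₗ[k] Tpow k V (m + 2))
    (h : ∀ a b s, F (Lm k V (n + 1) a (Lm k V n b s)) = Lm k V (m + 1) a (Lm k V m b (f s)))
    (x s) : F (LL k V n x s) = LL k V m x (f s) := by
  induction x using TensorProduct.induction_on with
  | zero => simp
  | tmul a b => exact h a b s
  | add x y hx hy => simp only [map_add, LinearMap.add_apply, hx, hy]

theorem T_Sm : ∀ i n a s, i + 2 ≤ n →
    RopT k V R i (n + 1) (Sm k V n a s) = Sm k V n a (RopT k V R i n s)
  | _, 0, _, _, h => by omega
  | _, 1, _, _, h => by omega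
  | 0, n + 2, a, s, _ => by
    have hS : ∀ x t, Sm k V (n + 2) a (LL k V n x t) = LL k V (n + 1) x (Sm k V n a t) := by
      intro x t
      exact LL_comm k V (Sm k V n a) (Sm k V (n + 2) a)
        (fun b c s => by rw [← LS_comm, ← LS_comm]) x t
    refine LL_ext k V (f := RopT k V R 0 (n + 3) ∘ₗ Sm k V (n + 2) a)
      (g := Sm k V (n + 2) a ∘ₗ RopT k V R 0 (n + 2)) (fun x s => ?_) s
    simp only [LinearMap.comp_apply]
    rw [hS, T_LL, T_LL, hS]
  | i + 1, n + 2, a, s, h => by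
    refine Lm_ext k V (f := RopT k V R (i + 1) (n + 3) ∘ₗ Sm k V (n + 2) a)
      (g := Sm k V (n + 2) a ∘ₗ RopT k V R (i + 1) (n + 2)) (fun b s => ?_) s
    simp only [LinearMap.comp_apply]
    rw [← LS_comm, T_Lm _ _ _ _ _ _ _ (by omega), T_Lm _ _ _ _ _ _ _ (by omega), ← LS_comm,
      T_Sm i (n + 1) a s (by omega)]

theorem T_far : ∀ i j n x, i + 2 ≤ j → j + 2 ≤ n →
    RopT k V R i n (RopT k V R j n x) = RopT k V R j n (RopT k V R i n x)
  | 0, 0, _, _, h, _ => by omega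
  | 0, 1, _, _, h, _ => by omega
  | 0, _ + 2, 0, _, _, h => by omega
  | 0, _ + 2, 1, _, _, h => by omega
  | 0, j + 2, n + 2, x, h, h' => by
    have hS : ∀ x t, RopT k V R (j + 2) (n + 2) (LL k V n x t) =
        LL k V n x (RopT k V R j n t) := by
      intro x t
      exact LL_comm k V _ _ (fun b c s => by
        rw [T_Lm _ _ _ _ _ _ _ (by omega), T_Lm _ _ _ _ _ _ _ (by omega)]) x t
    refine LL_ext k V (f := RopT k V R 0 (n + 2) ∘ₗ RopT k V R (j + 2) (n + 2))
      (g := RopT k V R (j + 2) (n + 2) ∘ₗ RopT k V R 0 (n + 2)) (fun x s => ?_) x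
    simp only [LinearMap.comp_apply]
    rw [hS, T_LL, T_LL, hS]
  | i + 1, 0, _, _, h, _ => by omega
  | i + 1, j + 1, 0, _, _, h => by omega
  | i + 1, j + 1, n + 1, x, h, h' => by
    refine Lm_ext k V (f := RopT k V R (i + 1) (n + 1) ∘ₗ RopT k V R (j + 1) (n + 1))
      (g := RopT k V R (j + 1) (n + 1) ∘ₗ RopT k V R (i + 1) (n + 1)) (fun b s => ?_) x
    simp only [LinearMap.comp_apply]
    rw [T_Lm _ _ _ _ _ _ _ (by omega), T_Lm _ _ _ _ _ _ _ (by omega),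
      T_Lm _ _ _ _ _ _ _ (by omega), T_Lm _ _ _ _ _ _ _ (by omega),
      T_far i j n s (by omega) (by omega)]

theorem T_braid (hb : SatisfiesBraid k V R) : ∀ i n x, i + 3 ≤ n →
    RopT k V R i n (RopT k V R (i + 1) n (RopT k V R i n x)) =
      RopT k V R (i + 1) n (RopT k V R i n (RopT k V R (i + 1) n x))
  | _, 0, _, h => by omega
  | _, 1, _, h => by omega
  | _, 2, _, h => by omega
  | 0, 3, x, _ => LinearMap.congr_fun hb x
  | 0, n + 4, x, _ => by
    refine Sm_ext k V (f := RopT k V R 0 (n + 4) ∘ₗ RopT k V R 1 (n + 4) ∘ₗ RopT k V R 0 (n + 4))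
      (g := RopT k V R 1 (n + 4) ∘ₗ RopT k V R 0 (n + 4) ∘ₗ RopT k V R 1 (n + 4))
      (fun b s => ?_) x
    simp only [LinearMap.comp_apply]
    have h0 := fun s => T_Sm k V R 0 (n + 3) b s (by omega)
    have h1 := fun s => T_Sm k V R 1 (n + 3) b s (by omega)
    rw [h0, h1, h0, h1, h0, h1]
    exact congrArg _ (T_braid hb 0 (n + 3) s (by omega))
  | i + 1, n + 3, x, h => by
    refine Lm_ext k V (f := RopT k V R (i + 1) (n + 3) ∘ₗ RopT k V R (i + 2) (n + 3) ∘ₗ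
        RopT k V R (i + 1) (n + 3))
      (g := RopT k V R (i + 2) (n + 3) ∘ₗ RopT k V R (i + 1) (n + 3) ∘ₗ RopT k V R (i + 2) (n + 3))
      (fun b s => ?_) x
    simp only [LinearMap.comp_apply]
    have h0 := fun s => T_Lm k V R i (n + 2) b s (by omega)
    have h1 := fun s => T_Lm k V R (i + 1) (n + 2) b s (by omega)
    rw [h0, h1, h0, h1, h0, h1]
    exact congrArg _ (T_braid hb i (n + 2) s (by omega))

theorem T_hecke (q : k) (hh : SatisfiesHecke k V R q) : ∀ i n x, i + 2 ≤ n →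
    RopT k V R i n (RopT k V R i n x) = (q - 1) • RopT k V R i n x + q • x
  | _, 0, _, h => by omega
  | _, 1, _, h => by omega
  | 0, n + 2, x, _ => by
    refine LL_ext k V (f := RopT k V R 0 (n + 2) ∘ₗ RopT k V R 0 (n + 2))
      (g := (q - 1) • RopT k V R 0 (n + 2) + q • LinearMap.id) (fun y s => ?_) x
    simp only [LinearMap.comp_apply, LinearMap.add_apply, LinearMap.smul_apply, LinearMap.id_apply]
    rw [T_LL, T_LL]
    have h : R (R y) = (q - 1) • R y + q • y := by
      have := LinearMap.congr_fun hh y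
      simp only [LinearMap.comp_apply, LinearMap.add_apply, LinearMap.sub_apply,
        LinearMap.smul_apply, LinearMap.id_apply, map_sub, map_smul, LinearMap.zero_apply] at this
      rw [← sub_eq_zero, ← this]
      module
    rw [h]
    simp only [map_add, map_smul, LinearMap.add_apply, LinearMap.smul_apply]
  | i + 1, n + 2, x, h => by
    refine Lm_ext k V (f := RopT k V R (i + 1) (n + 2) ∘ₗ RopT k V R (i + 1) (n + 2))
      (g := (q - 1) • RopT k V R (i + 1) (n + 2) + q • LinearMap.id) (fun b s => ?_) x
    simp only [LinearMap.comp_apply, LinearMap.add_apply, LinearMap.smul_apply, LinearMap.id_apply]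
    have h0 := fun s => T_Lm k V R i (n + 1) b s (by omega)
    rw [h0, h0, T_hecke q hh i (n + 1) s (by omega)]
    simp only [map_add, map_smul]

theorem T_surj (q : k) (hq : q ≠ 0) (hh : SatisfiesHecke k V R q) (i n : ℕ) (h : i + 2 ≤ n) :
    Function.Surjective (RopT k V R i n) := by
  intro x
  refine ⟨q⁻¹ • (RopT k V R i n x - (q - 1) • x), ?_⟩
  rw [map_smul, map_sub, map_smul, T_hecke k V R q hh i n x h, add_sub_cancel_left, smul_smul,
    inv_mul_cancel₀ hq, one_smul]

theorem Cl_T (φ : V →ₗ[k] k) (a v : V) : ∃ w, ∀ n s,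
    Cl k V φ (n + 1) (RopT k V R 0 (n + 2) (Lm k V (n + 1) a (Lm k V n v s))) = Lm k V n w s := by
  refine ⟨Cl k V φ 1 (R (a ⊗ₜ v)), fun n => ?_⟩
  induction n with
  | zero =>
    intro s
    have h : Lm k V 1 a (Lm k V 0 v s) = (show k from s) • (show Tpow k V 2 from a ⊗ₜ[k] v) := by
      change a ⊗ₜ[k] ((show k from s) • v) = (show k from s) • (a ⊗ₜ[k] v)
      rw [TensorProduct.tmul_smul]
    rw [h, map_smul, map_smul]; rfl
  | succ n ih =>
    intro s
    refine Sm_ext k V (f := Cl k V φ (n + 2) ∘ₗ RopT k V R 0 (n + 3) ∘ₗ Lm k V (n + 2) a ∘ₗ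
      Lm k V (n + 1) v) (g := Lm k V (n + 1) _) (fun b s => ?_) s
    simp only [LinearMap.comp_apply]
    rw [LS_comm, LS_comm, T_Sm _ _ _ _ _ _ _ (by omega), Cl_Sm, ih]
    exact (LS_comm k V n _ b s).symm

theorem Cr_T (φ : V →ₗ[k] k) (a v : V) : ∃ w, ∀ n s,
    Cr k V φ (n + 1) (RopT k V R n (n + 2) (Sm k V (n + 1) a (Sm k V n v s))) = Sm k V n w s := by
  refine ⟨Cr k V φ 1 (R (v ⊗ₜ a)), fun n => ?_⟩
  induction n with
  | zero =>
    intro s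
    have h : Sm k V 1 a (Sm k V 0 v s) = (show k from s) • (show Tpow k V 2 from v ⊗ₜ[k] a) := by
      change ((show k from s) • v) ⊗ₜ[k] a = (show k from s) • (v ⊗ₜ[k] a)
      rw [TensorProduct.smul_tmul']
    rw [h, map_smul, map_smul]; rfl
  | succ n ih =>
    intro s
    refine Lm_ext k V (f := Cr k V φ (n + 2) ∘ₗ RopT k V R (n + 1) (n + 3) ∘ₗ Sm k V (n + 2) a ∘ₗ
      Sm k V (n + 1) v) (g := Sm k V (n + 1) _) (fun b s => ?_) s
    simp only [LinearMap.comp_apply]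
    rw [← LS_comm, ← LS_comm, T_Lm _ _ _ _ _ _ _ (by omega), Cr_Lm, ih]
    exact LS_comm k V n b _ s

/-- The left-handed data. -/
def DL (q : k) (hq : q ≠ 0) (hb : SatisfiesBraid k V R) (hh : SatisfiesHecke k V R q) :
    BData k V q (Tpow k V) where
  L := Lm k V
  S := Sm k V
  C := fun n φ => Cl k V φ n
  T := RopT k V R
  comm := LS_comm k V
  TL := T_Lm k V R
  TS := T_Sm k V R
  spanL := Lm_span k V
  spanS := Sm_span k V
  CL := fun n φ => Cl_Lm k V φ n
  CT := Cl_T k V R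
  surj := T_surj k V R q hq hh
  braid := T_braid k V R hb
  far := T_far k V R

/-- The right-handed data. -/
def DR (q : k) (hq : q ≠ 0) (hb : SatisfiesBraid k V R) (hh : SatisfiesHecke k V R q) :
    BData k V q (Tpow k V) where
  L := Sm k V
  S := Lm k V
  C := fun n φ => Cr k V φ n
  T := fun i n => RopT k V R (n - 2 - i) n
  comm := fun n a b s => (LS_comm k V n b a s).symm
  TL := fun i n a s h => by
    rw [show n + 1 - 2 - (i + 1) = n - 2 - i by omega]
    exact T_Sm k V R _ n a s (by omega)
  TS := fun i n a s h => by
    rw [show n + 1 - 2 - i = n - 2 - i + 1 by omega]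
    exact T_Lm k V R _ n a s (by omega)
  spanL := Sm_span k V
  spanS := Lm_span k V
  CL := fun n φ => Cr_Sm k V φ n
  CT := Cr_T k V R
  surj := fun i n h => T_surj k V R q hq hh _ n (by omega)
  braid := fun i n x h => by
    rw [show n - 2 - i = n - 2 - (i + 1) + 1 by omega]
    exact (T_braid k V R hb _ n x (by omega)).symm
  far := fun i j n x h h' => (T_far k V R _ _ n x (by omega) (by omega)).symm

theorem DR_I (q : k) (hq : q ≠ 0) (hb : SatisfiesBraid k V R) (hh : SatisfiesHecke k V R q)
    (n : ℕ) : (DR k V R q hq hb hh).I n = Isub k V R q n := by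
  apply le_antisymm
  · refine iSup_le fun i => iSup_le fun hi => ?_
    exact le_iSup₂_of_le (f := fun i (_ : i + 2 ≤ n) =>
      LinearMap.ker (RopT k V R i n - q • LinearMap.id)) (n - 2 - i) (by omega) le_rfl
  · refine iSup_le fun i => iSup_le fun hi => ?_
    refine le_iSup₂_of_le (f := fun i (_ : i + 2 ≤ n) =>
      LinearMap.ker (RopT k V R (n - 2 - i) n - q • LinearMap.id)) (n - 2 - i) (by omega) ?_
    rw [show n - 2 - (n - 2 - i) = i by omega]

/-- Left insertion on positive tensor powers. -/
def consP (p : ℕ) : V →ₗ[k] TpowPos k V p →ₗ[k] TpowPos k V (p + 1) :=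
  TensorProduct.mk k V (TpowPos k V p)

theorem consP_ext {M : Type} [AddCommGroup M] [Module k M] {n : ℕ}
    {f g : TpowPos k V (n + 1) →ₗ[k] M}
    (h : ∀ a s, f (consP k V n a s) = g (consP k V n a s)) (x) : f x = g x :=
  Lm_ext k V (n := n + 1) (f := f) (g := g) h x

/-- Curried concatenation. -/
def mulC (r p : ℕ) : TpowPos k V p →ₗ[k] TpowPos k V r →ₗ[k] TpowPos k V (p + r + 1) :=
  TensorProduct.curry (mulAux k V r p)

/-- Right insertion, on positive tensor powers. -/
def snocP (p : ℕ) : TpowPos k V p →ₗ[k] V →ₗ[k] TpowPos k V (p + 1) :=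
  TensorProduct.curry (rmulAux k V p)

theorem mulC_cons (r p : ℕ) (x : TpowPos k V p) (b : V) (t : TpowPos k V r) :
    mulC k V (r + 1) p x (consP k V r b t) =
      castP k V (show (p + 1) + r + 1 = p + (r + 1) + 1 by omega)
        (mulC k V r (p + 1) (snocP k V p x b) t) := rfl

theorem snocP_cons (p : ℕ) (v : V) (x : TpowPos k V p) (b : V) :
    snocP k V (p + 1) (consP k V p v x) b = consP k V (p + 1) v (snocP k V p x b) := rfl

theorem castP_castP {a b c : ℕ} (h : a = b) (h' : b = c) (x) :
    castP k V h' (castP k V h x) = castP k V (h.trans h') x := by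
  subst h; subst h'; rfl

theorem consP_castP {a b : ℕ} (h : a = b) (v : V) (x : TpowPos k V a) :
    consP k V b v (castP k V h x) = castP k V (congrArg (· + 1) h) (consP k V a v x) := by
  subst h; rfl

theorem mulC_consL : ∀ r p (v : V) (x : TpowPos k V p) (t : TpowPos k V r),
    mulC k V r (p + 1) (consP k V p v x) t =
      castP k V (show p + r + 1 + 1 = p + 1 + r + 1 by omega)
        (consP k V (p + r + 1) v (mulC k V r p x t))
  | 0, p, v, x, t => rfl
  | r + 1, p, v, x, t => by
    refine consP_ext k V (f := mulC k V (r + 1) (p + 1) (consP k V p v x))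
      (g := castP k V (show p + (r + 1) + 1 + 1 = p + 1 + (r + 1) + 1 by omega) ∘ₗ
        consP k V (p + (r + 1) + 1) v ∘ₗ mulC k V (r + 1) p x) (fun b t => ?_) t
    simp only [LinearMap.comp_apply]
    rw [mulC_cons, mulC_cons, snocP_cons, mulC_consL r (p + 1), castP_castP, consP_castP,
      castP_castP]

/-- A vector as an element of the first tensor power. -/
def toP : V →ₗ[k] TpowPos k V 0 := LinearMap.id

theorem mulC_zero : ∀ r (a : V) (t : TpowPos k V r),
    mulC k V r 0 (toP k V a) t = castP k V (show r + 1 = 0 + r + 1 by omega) (consP k V r a t)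
  | 0, a, t => rfl
  | r + 1, a, t => by
    refine consP_ext k V (f := mulC k V (r + 1) 0 (toP k V a))
      (g := castP k V (show r + 1 + 1 = 0 + (r + 1) + 1 by omega) ∘ₗ consP k V (r + 1) a)
      (fun b t => ?_) t
    simp only [LinearMap.comp_apply]
    rw [mulC_cons]
    have h : snocP k V 0 (toP k V a) b = consP k V 0 a (toP k V b) := rfl
    rw [h, mulC_consL, mulC_zero r, castP_castP, consP_castP, castP_castP]

/-- The frozen casts preserve the relations. -/
theorem castT_mem (q : k) {a b c : ℕ} (h : a = b) (h' : b + 1 = c) (x : TpowPos k V a)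
    (y : TpowPos k V b) (hy : y = castP k V h x)
    (hm : (castT k V h' : Tpow k V (b + 1) →ₗ[k] Tpow k V c) y ∈ Isub k V R q c) :
    @Membership.mem (Tpow k V (a + 1)) _ _ (Isub k V R q (a + 1)) x := by
  subst h; subst h'; subst hy; exact hm

/-- let `R` be a Hecke symmetry on a finite dimensional `V` with
parameter `q ≠ 0`, and let `Λ(V,R) = T(V)/I` where `I` is generated by
`Ker(R - q·id)`, so that the degree-`n` part of `I` is `Isub q n` and
`Λ_n(V,R) = Tpow n / Isub q n`.  If `Λ_n(V,R) ≠ 0` for some `n > 1`, then for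
every nonzero `a ∈ Λ_1(V,R) = V` one has `a·Λ_{n-1} ≠ 0` and `Λ_{n-1}·a ≠ 0`. -/
theorem lambda_no_degree_one_annihilator [FiniteDimensional k V]
    (q : k) (hq : q ≠ 0) (hbraid : SatisfiesBraid k V R) (hhecke : SatisfiesHecke k V R q)
    (n : ℕ) (hn : 1 < n) (hΛn : Isub k V R q n ≠ ⊤)
    (a : Tpow k V 1) (ha : a ≠ 0) :
    (∃ t : Tpow k V (n - 1),
        mulT k V 1 (n - 1) (a ⊗ₜ[k] t) ∉ Isub k V R q (1 + (n - 1))) ∧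
    (∃ t : Tpow k V (n - 1),
        mulT k V (n - 1) 1 (t ⊗ₜ[k] a) ∉ Isub k V R q ((n - 1) + 1)) := by
  obtain ⟨m, rfl⟩ : ∃ m, n = m + 2 := ⟨n - 2, by omega⟩
  constructor
  · by_contra! h
    refine hΛn ((DL k V R q hq hbraid hhecke).main hq m a ha fun t => ?_)
    exact castT_mem k V R q _ _ _ _ (mulC_zero k V m a t) (h t)
  · by_contra! h
    refine hΛn ?_
    rw [← DR_I k V R q hq hbraid hhecke]
    refine (DR k V R q hq hbraid hhecke).main hq m a ha fun t => ?_
    rw [DR_I]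
    exact h t

end
end

section
/- Let R be a Hecke symmetry on V with parameter q and suppose dim Λ_n(V,R) = 1 and Λ_{n+1}(V,R) = 0 for some n ∈ {2, 3}. Then Λ(V,R) is a Frobenius algebra; equivalently, the multiplication pairings Λ_k(V,R) × Λ_{n-k}(V,R) → Λ_n(V,R) are nondegenerate for all 0 ≤ k ≤ n. -/
noncomputable section
open TensorProduct

variable (k : Type) [Field k] (V : Type) [AddCommGroup V] [Module k V]

variable (R : V ⊗[k] V →ₗ[k] V ⊗[k] V)

section Abstract
variable {K : Type} [Field K] {W Y U : Type} [AddCommGroup W] [Module K W]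
  [AddCommGroup Y] [Module K Y] [AddCommGroup U] [Module K U]

theorem half3 (q : K) (σ1 σ2 : Y →ₗ[K] Y) (s1 s2 s3 : W →ₗ[K] W)
    (l : U →ₗ[K] Y →ₗ[K] W) (f : Y →ₗ[K] K) (f1 f2 : W →ₗ[K] U)
    (hl2 : ∀ v y, s2 (l v y) = l v (σ1 y)) (hl3 : ∀ v y, s3 (l v y) = l v (σ2 y))
    (hspan : ∀ g h : W →ₗ[K] U, (∀ v y, g (l v y) = h (l v y)) → g = h)
    (hf2 : ∀ v y, f2 (l v y) = f y • v)
    (hker : ∀ y, f y = 0 → ∃ a b, σ1 a = 0 ∧ σ2 b = 0 ∧ y = a + b)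
    (h11 : ∀ x, s1 x = 0 → f1 x = 0) (h12 : ∀ x, s2 x = 0 → f1 x = 0)
    (hs1 : ∀ x, s1 (s1 x) = -(q + 1) • s1 x)
    (b12 : ∀ x, s1 (s2 (s1 x)) - q • s1 x = s2 (s1 (s2 x)) - q • s2 x)
    (b23 : ∀ x, s2 (s3 (s2 x)) - q • s2 x = s3 (s2 (s3 x)) - q • s3 x)
    (c13 : ∀ x, s1 (s3 x) = s3 (s1 x))
    (hvan : ∀ x, ∃ a b c, s1 a = 0 ∧ s2 b = 0 ∧ s3 c = 0 ∧ x = a + b + c)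
    (y0 : Y) (hy0 : f y0 = 1) :
    ∃ A : U →ₗ[K] U, (∀ x, A (f2 x) = q • f1 x - f1 (s3 (s2 x))) ∧
      ∀ x, q • f1 (s3 x) = -A (f2 (s1 x)) := by
  let M : W →ₗ[K] U := q • f1 - f1 ∘ₗ s3 ∘ₗ s2
  have hM : ∀ x, M x = q • f1 x - f1 (s3 (s2 x)) := fun x => rfl
  have hM2 : ∀ x, s2 x = 0 → M x = 0 := by
    intro x hx
    rw [hM, hx, h12 x hx]; simp
  have hM3 : ∀ x, s3 x = 0 → M x = 0 := by
    intro x hx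
    have h := b23 x
    rw [hx] at h
    have h' : s2 (q • x - s3 (s2 x)) = 0 := by
      rw [map_sub, map_smul]
      simp only [map_zero, smul_zero, sub_zero] at h
      rw [← neg_sub, h, neg_zero]
    have := h12 _ h'
    rw [hM]; simpa using this
  let A : U →ₗ[K] U := M ∘ₗ l.flip y0
  have hA : ∀ v, A v = M (l v y0) := fun v => rfl
  have hAf : A ∘ₗ f2 = M := by
    apply hspan
    intro v y
    rw [LinearMap.comp_apply, hf2, map_smul, hA]
    obtain ⟨a, b, ha, hb, hab⟩ := hker (y - f y • y0) (by simp [hy0])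
    have h1 : M (l v (y - f y • y0)) = 0 := by
      rw [hab, map_add, map_add, hM2 _ (by rw [hl2, ha, map_zero]),
        hM3 _ (by rw [hl3, hb, map_zero]), add_zero]
    rw [map_sub, map_sub, map_smul, map_smul, sub_eq_zero] at h1
    exact h1.symm
  have hAx : ∀ x, A (f2 x) = M x := fun x => by rw [← hAf]; rfl
  refine ⟨A, fun x => by rw [hAx, hM], fun x => ?_⟩
  obtain ⟨a, b, c, ha, hb, hc, rfl⟩ := hvan x
  have ea : q • f1 (s3 a) = - M (s1 a) := by
    rw [ha, map_zero, h11 (s3 a) (by rw [c13, ha, map_zero])]; simp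
  have ec : q • f1 (s3 c) = - M (s1 c) := by
    rw [hM3 (s1 c) (by rw [← c13, hc, map_zero]), hc]; simp
  have eb : q • f1 (s3 b) = - M (s1 b) := by
    have h1 : f1 (s1 b) = 0 := by
      have : f1 (s1 b + (q + 1) • b) = 0 := h11 _ (by
        rw [map_add, hs1, map_smul]; module)
      rw [map_add, map_smul, h12 b hb] at this
      simpa using this
    have h2 := b12 b
    rw [hb] at h2
    have h3 : s1 (s2 (s1 b) - q • b) = 0 := by
      rw [map_sub, map_smul, h2]; simp
    have h4 : f1 (s3 (s2 (s1 b) - q • b)) = 0 := h11 _ (by rw [c13, h3, map_zero])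
    rw [map_sub, map_sub, map_smul, map_smul, sub_eq_zero] at h4
    rw [hM, h1, h4]; simp
  simp only [hAx, map_add, smul_add, ea, eb, ec, neg_add]

theorem inv3 (q : K) (s1 s2 s3 : W →ₗ[K] W) (f1 f2 : W →ₗ[K] U) (A B : U →ₗ[K] U)
    (hA : ∀ x, A (f2 x) = q • f1 x - f1 (s3 (s2 x)))
    (hB : ∀ x, B (f1 x) = q • f2 x - f2 (s1 (s2 x)))
    (hB' : ∀ x, q • f2 (s1 x) = -B (f1 (s3 x))) (x : W) :
    B (A (f2 x)) = q ^ 2 • f2 x := by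
  have h := hB' (s2 x)
  have h1 : f1 (s3 (s2 x)) = q • f1 x - A (f2 x) := by rw [hA]; abel
  have h2 : f2 (s1 (s2 x)) = q • f2 x - B (f1 x) := by rw [hB]; abel
  rw [h1, h2, smul_sub] at h
  have h3 : B (A (f2 x)) = q • q • f2 x := by
    rw [map_sub, map_smul, neg_sub] at h
    rw [eq_comm, ← sub_eq_zero] at h ⊢
    rw [← neg_eq_zero, ← h]; abel
  rw [h3, smul_smul, pow_two]

theorem half2 (σ : Y →ₗ[K] Y) (s1 s2 : W →ₗ[K] W)
    (l : U →ₗ[K] Y →ₗ[K] W) (f : Y →ₗ[K] K) (f1 f2 : W →ₗ[K] U)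
    (hl2 : ∀ v y, s2 (l v y) = l v (σ y))
    (hspan : ∀ g h : W →ₗ[K] U, (∀ v y, g (l v y) = h (l v y)) → g = h)
    (hf2 : ∀ v y, f2 (l v y) = f y • v)
    (hker : ∀ y, f y = 0 → σ y = 0)
    (y0 : Y) (hy0 : f y0 = 1) :
    ∃ A : U →ₗ[K] U, ∀ x, A (f2 x) = f1 (s2 x) := by
  let M : W →ₗ[K] U := f1 ∘ₗ s2
  let A : U →ₗ[K] U := M ∘ₗ l.flip y0
  have hAf : A ∘ₗ f2 = M := by
    apply hspan
    intro v y
    rw [LinearMap.comp_apply, hf2, map_smul]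
    have h0 := hker (y - f y • y0) (by simp [hy0])
    have h1 : M (l v (y - f y • y0)) = 0 := by
      change f1 (s2 _) = 0
      rw [hl2, h0]; simp
    rw [map_sub, map_sub, map_smul, map_smul, sub_eq_zero] at h1
    exact h1.symm
  exact ⟨A, fun x => LinearMap.congr_fun hAf x⟩

theorem inv2 (q : K) (s1 s2 : W →ₗ[K] W) (f1 f2 : W →ₗ[K] U) (A B : U →ₗ[K] U)
    (hA : ∀ x, A (f2 x) = f1 (s2 x)) (hB : ∀ x, B (f1 x) = f2 (s1 x))
    (h22 : ∀ x, s2 x = 0 → f2 x = 0)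
    (b12 : ∀ x, s1 (s2 (s1 x)) - q • s1 x = s2 (s1 (s2 x)) - q • s2 x)
    (hvan : ∀ x, ∃ a b, s1 a = 0 ∧ s2 b = 0 ∧ x = a + b) (x : W) :
    B (A (f2 x)) = q • f2 x := by
  rw [hA, hB]
  obtain ⟨a, b, ha, hb, rfl⟩ := hvan x
  have h := b12 a
  rw [ha] at h
  have h3 : s2 (s1 (s2 a) - q • a) = 0 := by
    rw [map_sub, map_smul, ← h]; simp
  have h4 := h22 _ h3
  rw [map_sub, map_smul, sub_eq_zero] at h4
  simp only [map_add, hb, h22 b hb, h4]; simp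

/-- A functional vanishing on the kernel of `s` factors through `s`. -/
theorem factor_ker (s : Y →ₗ[K] Y) (f : Y →ₗ[K] K) (h : ∀ y, s y = 0 → f y = 0) :
    ∃ g : Y →ₗ[K] K, f = g ∘ₗ s := by
  have := LinearMap.exists_extend (p := LinearMap.range s)
    ((LinearMap.ker s).liftQ f (fun y hy => h y hy) ∘ₗ s.quotKerEquivRange.symm.toLinearMap)
  obtain ⟨g, hg⟩ := this
  refine ⟨g, LinearMap.ext fun y => ?_⟩
  have := LinearMap.congr_fun hg ⟨s y, y, rfl⟩
  simp only [LinearMap.comp_apply, Submodule.subtype_apply] at this ⊢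
  rw [this]
  have e : s.quotKerEquivRange.symm ⟨s y, y, rfl⟩ = (LinearMap.ker s).mkQ y := by
    rw [LinearEquiv.symm_apply_eq]; rfl
  change f y = (LinearMap.ker s).liftQ f _ (s.quotKerEquivRange.symm ⟨s y, y, rfl⟩)
  rw [e]; rfl

end Abstract

section Concrete
variable {k V}

/-- `s` on the first two factors of the third tensor power. -/
def opA (s : V ⊗[k] V →ₗ[k] V ⊗[k] V) (X : Type) [AddCommGroup X] [Module k X] :
    V ⊗[k] (V ⊗[k] X) →ₗ[k] V ⊗[k] (V ⊗[k] X) :=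
  (TensorProduct.assoc k V V X).toLinearMap ∘ₗ s.rTensor X ∘ₗ
    (TensorProduct.assoc k V V X).symm.toLinearMap

theorem opA_assoc (s : V ⊗[k] V →ₗ[k] V ⊗[k] V) (X : Type) [AddCommGroup X] [Module k X]
    (x : V ⊗[k] V) (y : X) :
    opA s X (TensorProduct.assoc k V V X (x ⊗ₜ y)) = TensorProduct.assoc k V V X (s x ⊗ₜ y) := by
  simp [opA]

/-- Reassociation. -/
def eqv : (V ⊗[k] (V ⊗[k] V)) ⊗[k] V ≃ₗ[k] V ⊗[k] (V ⊗[k] (V ⊗[k] V)) :=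
  TensorProduct.assoc k V (V ⊗[k] V) V ≪≫ₗ
    TensorProduct.congr (LinearEquiv.refl k V) (TensorProduct.assoc k V V V)

/-- contraction on the right -/
def ctr {X : Type} [AddCommGroup X] [Module k X] (f : X →ₗ[k] k) : V ⊗[k] X →ₗ[k] V :=
  (TensorProduct.rid k V).toLinearMap ∘ₗ f.lTensor V
/-- contraction on the left -/
def ctl {X : Type} [AddCommGroup X] [Module k X] (f : X →ₗ[k] k) : X ⊗[k] V →ₗ[k] V :=
  (TensorProduct.lid k V).toLinearMap ∘ₗ f.rTensor V

theorem ctr_tmul {X : Type} [AddCommGroup X] [Module k X] (f : X →ₗ[k] k) (v : V) (x : X) :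
    ctr f (v ⊗ₜ[k] x) = f x • v := by simp [ctr]
theorem ctl_tmul {X : Type} [AddCommGroup X] [Module k X] (f : X →ₗ[k] k) (v : V) (x : X) :
    ctl f (x ⊗ₜ[k] v) = f x • v := by simp [ctl]

theorem ctr_ker {X : Type} [AddCommGroup X] [Module k X] (f : X →ₗ[k] k) (s : X →ₗ[k] X)
    (h : ∀ y, s y = 0 → f y = 0) (z : V ⊗[k] X) (hz : s.lTensor V z = 0) : ctr f z = 0 := by
  obtain ⟨g, rfl⟩ := factor_ker s f h
  simp [ctr, LinearMap.lTensor_comp, hz]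
theorem ctl_ker {X : Type} [AddCommGroup X] [Module k X] (f : X →ₗ[k] k) (s : X →ₗ[k] X)
    (h : ∀ y, s y = 0 → f y = 0) (z : X ⊗[k] V) (hz : s.rTensor V z = 0) : ctl f z = 0 := by
  obtain ⟨g, rfl⟩ := factor_ker s f h
  simp [ctl, LinearMap.rTensor_comp, hz]

theorem eqv_tmul (x : V ⊗[k] V) (a b : V) :
    eqv ((TensorProduct.assoc k V V V (x ⊗ₜ[k] a)) ⊗ₜ[k] b) =
      TensorProduct.assoc k V V (V ⊗[k] V) (x ⊗ₜ (a ⊗ₜ b)) := by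
  induction x with
  | zero => simp
  | add x y hx hy => simp only [TensorProduct.add_tmul, map_add, hx, hy]
  | tmul c d => simp [eqv]

theorem eqv_tmul' (v : V) (x : V ⊗[k] V) (b : V) :
    eqv ((v ⊗ₜ[k] x) ⊗ₜ[k] b) = v ⊗ₜ[k] TensorProduct.assoc k V V V (x ⊗ₜ[k] b) := by
  simp [eqv]

theorem opA_eqv (s : V ⊗[k] V →ₗ[k] V ⊗[k] V) (z : (V ⊗[k] (V ⊗[k] V)) ⊗[k] V) :
    opA s (V ⊗[k] V) (eqv z) = eqv ((opA s V).rTensor V z) := by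
  induction z with
  | zero => simp
  | add x y hx hy => simp only [map_add, hx, hy]
  | tmul y b =>
    obtain ⟨y, rfl⟩ := (TensorProduct.assoc k V V V).surjective y
    induction y with
    | zero => simp
    | add x y hx hy => simp only [TensorProduct.add_tmul, map_add, hx, hy]
    | tmul x a =>
      rw [eqv_tmul, opA_assoc, LinearMap.rTensor_tmul, opA_assoc, eqv_tmul]

theorem lT_eqv (s : V ⊗[k] V →ₗ[k] V ⊗[k] V) (z : (V ⊗[k] (V ⊗[k] V)) ⊗[k] V) :
    (opA s V).lTensor V (eqv z) = eqv ((s.lTensor V).rTensor V z) := by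
  induction z with
  | zero => simp
  | add x y hx hy => simp only [map_add, hx, hy]
  | tmul y b =>
    induction y with
    | zero => simp
    | add x y hx hy => simp only [TensorProduct.add_tmul, map_add, hx, hy]
    | tmul v x =>
      rw [eqv_tmul', LinearMap.lTensor_tmul, opA_assoc, LinearMap.rTensor_tmul,
        LinearMap.lTensor_tmul, eqv_tmul']

theorem lTensor_hecke {X : Type} [AddCommGroup X] [Module k X] (c : k) (s : X →ₗ[k] X)
    (h : ∀ x, s (s x) = c • s x) (z : V ⊗[k] X) :
    s.lTensor V (s.lTensor V z) = c • s.lTensor V z := by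
  induction z with
  | zero => simp
  | add x y hx hy => simp only [map_add, hx, hy, smul_add]
  | tmul v x => simp [h]

theorem opA_hecke {X : Type} [AddCommGroup X] [Module k X] (c : k)
    (s : V ⊗[k] V →ₗ[k] V ⊗[k] V)
    (h : ∀ x, s (s x) = c • s x) (z : V ⊗[k] (V ⊗[k] X)) :
    opA s X (opA s X z) = c • opA s X z := by
  obtain ⟨z, rfl⟩ := (TensorProduct.assoc k V V X).surjective z
  induction z with
  | zero => simp
  | add x y hx hy => simp only [map_add, hx, hy, smul_add]
  | tmul x y =>
    simp only [opA_assoc, h, ← TensorProduct.smul_tmul', map_smul]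

theorem sep_right {X : Type} [AddCommGroup X] [Module k X]
    (B : V →ₗ[k] X →ₗ[k] k) (hB : ∀ v, (∀ x, B v x = 0) → v = 0)
    (z : V ⊗[k] V) (hz : ∀ y, ctr (B.flip y) z = 0) : z = 0 := by
  classical
  let b := Module.Basis.ofVectorSpace k V
  let e := TensorProduct.equivFinsuppOfBasisLeft b (N := V)
  have key : ∀ (z : V ⊗[k] V) i y, B (e z i) y = b.coord i (ctr (B.flip y) z) := by
    intro z i y
    induction z with
    | zero => simp
    | add x y hx hy => simp only [map_add, Finsupp.add_apply, LinearMap.add_apply, hx, hy]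
    | tmul v w =>
      simp [e, ctr_tmul, mul_comm]
  apply e.injective
  rw [map_zero]
  ext i
  apply hB
  intro y
  rw [key, hz, map_zero]

theorem sep_left {X : Type} [AddCommGroup X] [Module k X]
    (B : V →ₗ[k] X →ₗ[k] k) (hB : ∀ v, (∀ x, B v x = 0) → v = 0)
    (z : V ⊗[k] V) (hz : ∀ y, ctl (B.flip y) z = 0) : z = 0 := by
  have h : TensorProduct.comm k V V z = 0 := by
    apply sep_right B hB
    intro y
    rw [← hz y]
    clear hz
    induction z with
    | zero => simp
    | add x y hx hy => simp only [map_add, hx, hy]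
    | tmul v w => simp [ctr_tmul, ctl_tmul]
  simpa using h

theorem main2 (q : k) (hq : q ≠ 0) (s : V ⊗[k] V →ₗ[k] V ⊗[k] V)
    (hb : ∀ x, opA s V (s.lTensor V (opA s V x)) - q • opA s V x =
      s.lTensor V (opA s V (s.lTensor V x)) - q • s.lTensor V x)
    (f : V ⊗[k] V →ₗ[k] k) (y0 : V ⊗[k] V) (hy0 : f y0 = 1) (hf : ∀ y, f y = 0 ↔ s y = 0)
    (hvan : ∀ x, ∃ a b, opA s V a = 0 ∧ s.lTensor V b = 0 ∧ x = a + b) :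
    (∀ v, (∀ w, f (v ⊗ₜ w) = 0) → v = 0) ∧ (∀ v, (∀ w, f (w ⊗ₜ v) = 0) → v = 0) := by
  let al := TensorProduct.assoc k V V V
  let f2 : V ⊗[k] (V ⊗[k] V) →ₗ[k] V := ctr f
  let f1 : V ⊗[k] (V ⊗[k] V) →ₗ[k] V := ctl f ∘ₗ al.symm.toLinearMap
  let l : V →ₗ[k] (V ⊗[k] V) →ₗ[k] V ⊗[k] (V ⊗[k] V) := TensorProduct.mk k V (V ⊗[k] V)
  let r : V →ₗ[k] (V ⊗[k] V) →ₗ[k] V ⊗[k] (V ⊗[k] V) :=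
    ((TensorProduct.mk k (V ⊗[k] V) V).compr₂ al.toLinearMap).flip
  have hl : ∀ v y, l v y = v ⊗ₜ y := fun v y => rfl
  have hr : ∀ v y, r v y = al (y ⊗ₜ v) := fun v y => rfl
  have hf2 : ∀ v y, f2 (l v y) = f y • v := fun v y => ctr_tmul f v y
  have hf1 : ∀ v y, f1 (r v y) = f y • v := fun v y => by
    simp [f1, hr, ctl_tmul]
  have h22 : ∀ x, s.lTensor V x = 0 → f2 x = 0 := ctr_ker f s fun y => (hf y).2
  have h11 : ∀ x, opA s V x = 0 → f1 x = 0 := by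
    intro x hx
    refine ctl_ker f s (fun y => (hf y).2) _ ?_
    simpa [opA] using hx
  have hl2 : ∀ v y, s.lTensor V (l v y) = l v (s y) := fun v y => by simp [hl]
  have hr1 : ∀ v y, opA s V (r v y) = r v (s y) := fun v y => opA_assoc s V y v
  obtain ⟨A, hA⟩ := half2 s (opA s V) (s.lTensor V) l f f1 f2 hl2
    (fun g h H => TensorProduct.ext' H) hf2 (fun y => (hf y).1) y0 hy0
  obtain ⟨B, hB⟩ := half2 s (s.lTensor V) (opA s V) r f f2 f1 hr1
    (fun g h H => by
      have : g ∘ₗ al.toLinearMap = h ∘ₗ al.toLinearMap := TensorProduct.ext' fun x y => H y x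
      refine LinearMap.ext fun x => ?_
      obtain ⟨x, rfl⟩ := al.surjective x
      exact LinearMap.congr_fun this x) hf1 (fun y => (hf y).1) y0 hy0
  have hBA := inv2 q _ _ f1 f2 A B hA hB h22 hb hvan
  have hAB := inv2 q _ _ f2 f1 B A hB hA h11 (fun x => (hb x).symm) (fun x => by
    obtain ⟨a, b, ha, hb, e⟩ := hvan x
    exact ⟨b, a, hb, ha, by rw [e, add_comm]⟩)
  constructor
  · intro v hv
    have h0 : ∀ y, f1 (l v y) = 0 := by
      intro y
      induction y with
      | zero => simp
      | add x y hx hy => simp only [map_add, hx, hy, add_zero]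
      | tmul a b => simp [hl, f1, al, ctl_tmul, hv]
    have h := hBA (l v y0)
    rw [hA, hl2, h0, hf2, hy0, one_smul, map_zero] at h
    exact (smul_eq_zero.1 h.symm).resolve_left hq
  · intro v hv
    have h0 : ∀ y, f2 (r v y) = 0 := by
      intro y
      induction y with
      | zero => simp
      | add x y hx hy => simp only [map_add, hx, hy, add_zero]
      | tmul a b => simp [hr, f2, al, ctr_tmul, hv]
    have h := hAB (r v y0)
    rw [hB, hr1, h0, hf1, hy0, one_smul, map_zero] at h
    exact (smul_eq_zero.1 h.symm).resolve_left hq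

set_option maxHeartbeats 1000000 in
theorem main3 (q : k) (hq : q ≠ 0) (s : V ⊗[k] V →ₗ[k] V ⊗[k] V)
    (hs : ∀ x, s (s x) = -(q + 1) • s x)
    (hb : ∀ x, opA s V (s.lTensor V (opA s V x)) - q • opA s V x =
      s.lTensor V (opA s V (s.lTensor V x)) - q • s.lTensor V x)
    (f : V ⊗[k] (V ⊗[k] V) →ₗ[k] k) (y0 : V ⊗[k] (V ⊗[k] V)) (hy0 : f y0 = 1)
    (hf : ∀ y, f y = 0 ↔ ∃ a b, opA s V a = 0 ∧ s.lTensor V b = 0 ∧ y = a + b)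
    (hvan : ∀ x : V ⊗[k] (V ⊗[k] (V ⊗[k] V)), ∃ a b c, opA s (V ⊗[k] V) a = 0 ∧
      (opA s V).lTensor V b = 0 ∧ (s.lTensor V).lTensor V c = 0 ∧ x = a + b + c) :
    (∀ v, (∀ x, f (v ⊗ₜ x) = 0) → v = 0) ∧
    (∀ v, (∀ x, f (TensorProduct.assoc k V V V (x ⊗ₜ v)) = 0) → v = 0) ∧
    (∀ x, (∀ v, f (TensorProduct.assoc k V V V (x ⊗ₜ v)) = 0) → s x = 0) ∧
    (∀ x, (∀ v, f (v ⊗ₜ x) = 0) → s x = 0) := by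
  let V3 := V ⊗[k] (V ⊗[k] V)
  let V4 := V ⊗[k] (V ⊗[k] (V ⊗[k] V))
  let f2 : V ⊗[k] (V ⊗[k] (V ⊗[k] V)) →ₗ[k] V := ctr f
  let f1 : V ⊗[k] (V ⊗[k] (V ⊗[k] V)) →ₗ[k] V := ctl f ∘ₗ eqv.symm.toLinearMap
  let l : V →ₗ[k] (V ⊗[k] (V ⊗[k] V)) →ₗ[k] V ⊗[k] (V ⊗[k] (V ⊗[k] V)) :=
    TensorProduct.mk k V (V ⊗[k] (V ⊗[k] V))
  let r : V →ₗ[k] (V ⊗[k] (V ⊗[k] V)) →ₗ[k] V ⊗[k] (V ⊗[k] (V ⊗[k] V)) :=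
    ((TensorProduct.mk k (V ⊗[k] (V ⊗[k] V)) V).compr₂ eqv.toLinearMap).flip
  let s1 := opA s (V ⊗[k] V)
  let s2 := (opA s V).lTensor V
  let s3 := (s.lTensor V).lTensor V
  have hl : ∀ v y, l v y = v ⊗ₜ y := fun v y => rfl
  have hr : ∀ v y, r v y = eqv (y ⊗ₜ v) := fun v y => rfl
  have hf2 : ∀ v y, f2 (l v y) = f y • v := fun v y => ctr_tmul f v y
  have hf1 : ∀ v y, f1 (r v y) = f y • v := fun v y => by
    simp [f1, hr, ctl_tmul]
  have hfa : ∀ y, opA s V y = 0 → f y = 0 := fun y hy =>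
    (hf y).2 ⟨y, 0, hy, map_zero _, by simp⟩
  have hfb : ∀ y, s.lTensor V y = 0 → f y = 0 := fun y hy =>
    (hf y).2 ⟨0, y, map_zero _, hy, by simp⟩
  have h22 : ∀ x, s2 x = 0 → f2 x = 0 := ctr_ker f _ hfa
  have h23 : ∀ x, s3 x = 0 → f2 x = 0 := ctr_ker f _ hfb
  have h11 : ∀ x, s1 x = 0 → f1 x = 0 := by
    intro x hx
    obtain ⟨x, rfl⟩ := eqv.surjective x
    refine ctl_ker f _ hfa _ ?_
    simpa [s1, opA_eqv] using hx
  have h12 : ∀ x, s2 x = 0 → f1 x = 0 := by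
    intro x hx
    obtain ⟨x, rfl⟩ := eqv.surjective x
    refine ctl_ker f _ hfb _ ?_
    simpa [s2, lT_eqv] using hx
  have hl2 : ∀ v y, s2 (l v y) = l v (opA s V y) := fun v y => by simp [hl, s2]
  have hl3 : ∀ v y, s3 (l v y) = l v (s.lTensor V y) := fun v y => by simp [hl, s3]
  have hr1 : ∀ v y, s1 (r v y) = r v (opA s V y) := fun v y => by simp [hr, s1, opA_eqv]
  have hr2 : ∀ v y, s2 (r v y) = r v (s.lTensor V y) := fun v y => by simp [hr, s2, lT_eqv]
  have hspl : ∀ {M : Type} [AddCommGroup M] [Module k M] (g h : V ⊗[k] (V ⊗[k] (V ⊗[k] V)) →ₗ[k] M),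
      (∀ v y, g (l v y) = h (l v y)) → g = h := fun g h H => TensorProduct.ext' H
  have hspr : ∀ {M : Type} [AddCommGroup M] [Module k M] (g h : V ⊗[k] (V ⊗[k] (V ⊗[k] V)) →ₗ[k] M),
      (∀ v y, g (r v y) = h (r v y)) → g = h := fun g h H => by
    have : g ∘ₗ eqv.toLinearMap = h ∘ₗ eqv.toLinearMap := TensorProduct.ext' fun x y => H y x
    refine LinearMap.ext fun x => ?_
    obtain ⟨x, rfl⟩ := eqv.surjective x
    exact LinearMap.congr_fun this x
  have b12 : ∀ x, s1 (s2 (s1 x)) - q • s1 x = s2 (s1 (s2 x)) - q • s2 x := by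
    intro x
    refine LinearMap.congr_fun (hspr (s1 ∘ₗ s2 ∘ₗ s1 - q • s1) (s2 ∘ₗ s1 ∘ₗ s2 - q • s2) ?_) x
    intro v y
    simp only [LinearMap.sub_apply, LinearMap.comp_apply, LinearMap.smul_apply, hr1, hr2]
    have h := congrArg (r v) (hb y)
    simpa only [map_sub, map_smul] using h
  have b23 : ∀ x, s2 (s3 (s2 x)) - q • s2 x = s3 (s2 (s3 x)) - q • s3 x := by
    intro x
    refine LinearMap.congr_fun (hspl (s2 ∘ₗ s3 ∘ₗ s2 - q • s2) (s3 ∘ₗ s2 ∘ₗ s3 - q • s3) ?_) x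
    intro v y
    simp only [LinearMap.sub_apply, LinearMap.comp_apply, LinearMap.smul_apply, hl2, hl3]
    have h := congrArg (l v) (hb y)
    simpa only [map_sub, map_smul] using h
  let c := TensorProduct.assoc k V V (V ⊗[k] V)
  have hc1 : ∀ x y, s1 (c (x ⊗ₜ y)) = c (s x ⊗ₜ y) := fun x y => opA_assoc s _ x y
  have hc3 : ∀ x y, s3 (c (x ⊗ₜ y)) = c (x ⊗ₜ s y) := by
    intro x y
    induction x with
    | zero => simp
    | add x y hx hy => simp only [TensorProduct.add_tmul, map_add, hx, hy]
    | tmul a b => simp [c, s3]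
  have c13 : ∀ x, s1 (s3 x) = s3 (s1 x) := by
    intro x
    obtain ⟨x, rfl⟩ := c.surjective x
    induction x with
    | zero => simp
    | add x y hx hy => simp only [map_add, hx, hy]
    | tmul x y => simp only [hc1, hc3]
  have hs1 : ∀ x, s1 (s1 x) = -(q + 1) • s1 x := opA_hecke _ s hs
  have hs3 : ∀ x, s3 (s3 x) = -(q + 1) • s3 x := lTensor_hecke _ _ (lTensor_hecke _ s hs)
  obtain ⟨A, hA, hA'⟩ := half3 q (opA s V) (s.lTensor V) s1 s2 s3 l f f1 f2 hl2 hl3 hspl hf2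
    (fun y => (hf y).1) h11 h12 hs1 b12 b23 c13 hvan y0 hy0
  obtain ⟨B, hB, hB'⟩ := half3 q (s.lTensor V) (opA s V) s3 s2 s1 r f f2 f1 hr2 hr1 hspr hf1
    (fun y hy => by
      obtain ⟨a, b, ha, hb, e⟩ := (hf y).1 hy
      exact ⟨b, a, hb, ha, by rw [e, add_comm]⟩) h23 h22 hs3
    (fun x => (b23 x).symm) (fun x => (b12 x).symm) (fun x => (c13 x).symm)
    (fun x => by
      obtain ⟨a, b, d, ha, hb, hd, e⟩ := hvan x
      exact ⟨d, b, a, hd, hb, ha, by rw [e]; abel⟩) y0 hy0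
  have hBA := inv3 q s1 s2 s3 f1 f2 A B hA hB hB'
  have hAB := inv3 q s3 s2 s1 f2 f1 B A hB hA hA'
  have hA0 : ∀ v, A v = 0 → v = 0 := by
    intro v hv
    have h := hBA (l v y0)
    rw [hf2, hy0, one_smul, hv, map_zero] at h
    exact (smul_eq_zero.1 h.symm).resolve_left (pow_ne_zero 2 hq)
  have hB0 : ∀ v, B v = 0 → v = 0 := by
    intro v hv
    have h := hAB (r v y0)
    rw [hf1, hy0, one_smul, hv, map_zero] at h
    exact (smul_eq_zero.1 h.symm).resolve_left (pow_ne_zero 2 hq)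
  have hL : ∀ v, (∀ x, f (v ⊗ₜ x) = 0) → v = 0 := by
    intro v hv
    have h0 : ∀ y, f1 (l v y) = 0 := by
      intro y
      obtain ⟨y, rfl⟩ := (TensorProduct.assoc k V V V).surjective y
      induction y with
      | zero => simp
      | add x y hx hy => simp only [map_add, hx, hy, add_zero]
      | tmul a b =>
        have e : l v (TensorProduct.assoc k V V V (a ⊗ₜ b)) = r b (v ⊗ₜ a) :=
          (eqv_tmul' v a b).symm
        rw [e, hf1, hv, zero_smul]
    have h := hA (l v y0)
    rw [hl2, hl3, h0, h0, hf2, hy0, one_smul] at h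
    exact hA0 v (by simpa using h)
  have hR : ∀ v, (∀ x, f (TensorProduct.assoc k V V V (x ⊗ₜ v)) = 0) → v = 0 := by
    intro v hv
    have h0 : ∀ y, f2 (r v y) = 0 := by
      intro y
      induction y with
      | zero => simp
      | add x y hx hy => simp only [map_add, hx, hy, add_zero]
      | tmul a b =>
        have e : r v (a ⊗ₜ b) = l a (TensorProduct.assoc k V V V (b ⊗ₜ v)) := eqv_tmul' a b v
        rw [e, hf2, hv, zero_smul]
    have h := hB (r v y0)
    rw [hr2, hr1, h0, h0, hf1, hy0, one_smul] at h
    exact hB0 v (by simpa using h)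
  -- contractions of `c (x ⊗ y)`
  have hcl : ∀ x y, f2 (c (x ⊗ₜ y)) =
      ctr ((TensorProduct.lift.equiv (.id k) V (V ⊗[k] V) k).symm f |>.flip y) x := by
    intro x y
    induction x with
    | zero => simp
    | add x y hx hy => simp only [TensorProduct.add_tmul, map_add, hx, hy]
    | tmul a b => simp [c, ctr_tmul, f2]
  have hcr : ∀ x y, f1 (c (x ⊗ₜ y)) =
      ctl (f ∘ₗ (TensorProduct.assoc k V V V).toLinearMap ∘ₗ TensorProduct.mk k (V ⊗[k] V) V x) y := by
    intro x y
    induction y with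
    | zero => simp
    | add x y hx hy => simp only [TensorProduct.tmul_add, map_add, hx, hy]
    | tmul a b =>
      simp only [c, ← eqv_tmul, ctl_tmul]
      exact hf1 _ _
  refine ⟨hL, hR, ?_, ?_⟩
  · intro x hx
    refine sep_right _ (fun v hv => hL v hv) _ fun y => (hcl (s x) y).symm.trans ?_
    apply hA0
    have h := hA' (c (x ⊗ₜ y))
    rw [hc3, hc1, hcr] at h
    have e : (f ∘ₗ (TensorProduct.assoc k V V V).toLinearMap ∘ₗ
        TensorProduct.mk k (V ⊗[k] V) V x) = 0 := LinearMap.ext hx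
    rw [e] at h
    have e2 : ctl (V := V) (0 : V →ₗ[k] k) = 0 := by simp [ctl]
    rw [e2] at h
    simpa using h.symm
  · intro x hx
    refine sep_left ((TensorProduct.mk k (V ⊗[k] V) V).compr₂
      (f ∘ₗ (TensorProduct.assoc k V V V).toLinearMap)).flip (fun v hv => hR v hv) _
      fun y => (hcr y (s x)).symm.trans ?_
    apply hB0
    have h := hB' (c (y ⊗ₜ x))
    rw [hc3, hc1, hcl] at h
    have e : ((TensorProduct.lift.equiv (.id k) V (V ⊗[k] V) k).symm f).flip x = 0 :=
      LinearMap.ext hx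
    rw [e] at h
    have e2 : ctr (V := V) (0 : V →ₗ[k] k) = 0 := by simp [ctr]
    rw [e2] at h
    simpa using h.symm

theorem opA_sub (q : k) (R : V ⊗[k] V →ₗ[k] V ⊗[k] V) (X : Type) [AddCommGroup X] [Module k X]
    (x : V ⊗[k] (V ⊗[k] X)) :
    opA (R - q • LinearMap.id) X x = opA R X x - q • x := by
  obtain ⟨x, rfl⟩ := (TensorProduct.assoc k V V X).surjective x
  simp [opA, LinearMap.rTensor_sub, LinearMap.rTensor_smul]

theorem lT_sub {X : Type} [AddCommGroup X] [Module k X] (q : k) (R S : X →ₗ[k] X)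
    (h : ∀ x, S x = R x - q • x) (x : V ⊗[k] X) :
    S.lTensor V x = R.lTensor V x - q • x := by
  have : S = R - q • LinearMap.id := LinearMap.ext h
  subst this
  simp [LinearMap.lTensor_sub, LinearMap.lTensor_smul]

theorem braid_sub (q : k) (R : V ⊗[k] V →ₗ[k] V ⊗[k] V)
    (hbraid : SatisfiesBraid k V R) (hhecke : SatisfiesHecke k V R q) :
    (∀ x, (R - q • LinearMap.id : V ⊗[k] V →ₗ[k] V ⊗[k] V)
      ((R - q • LinearMap.id : V ⊗[k] V →ₗ[k] V ⊗[k] V) x) =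
        -(q + 1) • (R - q • LinearMap.id : V ⊗[k] V →ₗ[k] V ⊗[k] V) x) ∧
    ∀ x, opA (R - q • LinearMap.id) V ((R - q • LinearMap.id).lTensor V
        (opA (R - q • LinearMap.id) V x)) - q • opA (R - q • LinearMap.id) V x =
      (R - q • LinearMap.id).lTensor V (opA (R - q • LinearMap.id) V
        ((R - q • LinearMap.id).lTensor V x)) - q • (R - q • LinearMap.id).lTensor V x := by
  have hs : ∀ x, (R - q • LinearMap.id : V ⊗[k] V →ₗ[k] V ⊗[k] V)
      ((R - q • LinearMap.id : V ⊗[k] V →ₗ[k] V ⊗[k] V) x) =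
        -(q + 1) • (R - q • LinearMap.id : V ⊗[k] V →ₗ[k] V ⊗[k] V) x := by
    intro x
    have h := LinearMap.congr_fun hhecke x
    have h' : R ((R - q • LinearMap.id : V ⊗[k] V →ₗ[k] V ⊗[k] V) x) +
      (R - q • LinearMap.id : V ⊗[k] V →ₗ[k] V ⊗[k] V) x = 0 := h
    generalize (R - q • LinearMap.id : V ⊗[k] V →ₗ[k] V ⊗[k] V) x = y at h' ⊢
    simp only [LinearMap.sub_apply, LinearMap.smul_apply, LinearMap.id_apply]
    rw [eq_neg_of_add_eq_zero_left h']
    module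
  refine ⟨hs, fun x => ?_⟩
  have h1 := opA_hecke (X := V) _ _ hs
  have h2 := lTensor_hecke (V := V) _ _ hs
  have e1 : ∀ x, opA R V x = opA (R - q • LinearMap.id) V x + q • x := fun x => by
    rw [opA_sub]; abel
  have e2 : ∀ x, R.lTensor V x = (R - q • LinearMap.id).lTensor V x + q • x := fun x => by
    rw [lT_sub q R (R - q • LinearMap.id) (fun x => rfl)]; abel
  have hb : opA R V (R.lTensor V (opA R V x)) = R.lTensor V (opA R V (R.lTensor V x)) :=
    LinearMap.congr_fun hbraid x
  simp only [e1, e2] at hb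
  generalize opA (R - q • LinearMap.id) V = S1 at *
  generalize (R - q • LinearMap.id).lTensor V = S2 at *
  simp only [map_add, map_smul, smul_add, h1, h2] at hb
  rw [← sub_eq_zero] at hb ⊢
  rw [← hb]
  module

theorem Isub2 (R : V ⊗[k] V →ₗ[k] V ⊗[k] V) (q : k) (x : V ⊗[k] V) :
    (show Tpow k V 2 from x) ∈ Isub k V R q 2 ↔
      (R - q • LinearMap.id : V ⊗[k] V →ₗ[k] V ⊗[k] V) x = 0 := by
  have h : Isub k V R q 2 = LinearMap.ker (RopT k V R 0 2 - q • LinearMap.id) := by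
    apply le_antisymm
    · refine iSup₂_le fun i hi => ?_
      obtain rfl : i = 0 := by omega
      exact le_rfl
    · exact le_iSup₂_of_le 0 (by omega) le_rfl
  rw [h]
  exact Iff.rfl

theorem Isub3 (R : V ⊗[k] V →ₗ[k] V ⊗[k] V) (q : k) (x : V ⊗[k] (V ⊗[k] V)) :
    (show Tpow k V 3 from x) ∈ Isub k V R q 3 ↔ ∃ a b, opA (R - q • LinearMap.id) V a = 0 ∧
      (R - q • LinearMap.id).lTensor V b = 0 ∧ x = a + b := by
  have h : Isub k V R q 3 = LinearMap.ker (RopT k V R 0 3 - q • LinearMap.id) ⊔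
      LinearMap.ker (RopT k V R 1 3 - q • LinearMap.id) := by
    apply le_antisymm
    · refine iSup₂_le fun i hi => ?_
      obtain rfl | rfl : i = 0 ∨ i = 1 := by omega
      · exact le_sup_left
      · exact le_sup_right
    · exact sup_le (le_iSup₂_of_le 0 (by omega) le_rfl) (le_iSup₂_of_le 1 (by omega) le_rfl)
  rw [h, Submodule.mem_sup]
  constructor
  · rintro ⟨a, ha, b, hb, e⟩
    exact ⟨a, b, (opA_sub q R V a).trans ha,
      (lT_sub q R (R - q • LinearMap.id) (fun x => rfl) b).trans hb, e.symm⟩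
  · rintro ⟨a, b, ha, hb, e⟩
    exact ⟨a, (opA_sub q R V a).symm.trans ha, b,
      (lT_sub q R (R - q • LinearMap.id) (fun x => rfl) b).symm.trans hb, e.symm⟩

theorem Isub4 (R : V ⊗[k] V →ₗ[k] V ⊗[k] V) (q : k) (x : V ⊗[k] (V ⊗[k] (V ⊗[k] V)))
    (hx : (show Tpow k V 4 from x) ∈ Isub k V R q 4) :
    ∃ a b c, opA (R - q • LinearMap.id) (V ⊗[k] V) a = 0 ∧
      (opA (R - q • LinearMap.id) V).lTensor V b = 0 ∧
      ((R - q • LinearMap.id).lTensor V).lTensor V c = 0 ∧ x = a + b + c := by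
  have h : Isub k V R q 4 ≤ (LinearMap.ker (RopT k V R 0 4 - q • LinearMap.id) ⊔
      LinearMap.ker (RopT k V R 1 4 - q • LinearMap.id)) ⊔
      LinearMap.ker (RopT k V R 2 4 - q • LinearMap.id) := by
    refine iSup₂_le fun i hi => ?_
    obtain rfl | rfl | rfl : i = 0 ∨ i = 1 ∨ i = 2 := by omega
    · exact le_sup_left.trans le_sup_left
    · exact le_sup_right.trans le_sup_left
    · exact le_sup_right
  obtain ⟨y, hy, c, hc, e⟩ := Submodule.mem_sup.1 (h hx)
  obtain ⟨a, ha, b, hb, e'⟩ := Submodule.mem_sup.1 hy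
  refine ⟨a, b, c, (opA_sub q R _ a).trans ha,
    (lT_sub q (opA R V) _ (opA_sub q R V) b).trans hb,
    (lT_sub q (R.lTensor V) _ (lT_sub q R _ (fun x => rfl)) c).trans hc, ?_⟩
  subst e'
  exact e.symm

theorem exists_functional {X : Type} [AddCommGroup X] [Module k X] (I : Submodule k X)
    (h : Module.finrank k (X ⧸ I) = 1) :
    ∃ (f : X →ₗ[k] k) (y0 : X), f y0 = 1 ∧ ∀ y, f y = 0 ↔ y ∈ I := by
  have : FiniteDimensional k (X ⧸ I) := Module.finite_of_finrank_eq_succ h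
  let e : (X ⧸ I) ≃ₗ[k] k := LinearEquiv.ofFinrankEq _ _ (by rw [h, Module.finrank_self])
  obtain ⟨y0, hy0⟩ := I.mkQ_surjective (e.symm 1)
  refine ⟨e.toLinearMap ∘ₗ I.mkQ, y0, ?_, fun y => ?_⟩
  · simp only [LinearMap.comp_apply, hy0]; simp
  · simp

end Concrete

/-- let `R` be a Hecke symmetry on a finite dimensional `V` with
parameter `q ≠ 0`, and suppose `dim Λ_n(V,R) = 1` and `Λ_{n+1}(V,R) = 0` for
some `n ∈ {2,3}` (where `Λ_m(V,R) = Tpow m / Isub q m`).  Then the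
multiplication pairings `Λ_p × Λ_r → Λ_{p+r}` with `p + r = n` are all
nondegenerate (i.e. `Λ(V,R)` is a Frobenius algebra). -/
theorem lambda_frobenius_low_degree [FiniteDimensional k V]
    (q : k) (hq : q ≠ 0) (hbraid : SatisfiesBraid k V R) (hhecke : SatisfiesHecke k V R q)
    (n : ℕ) (hn : n = 2 ∨ n = 3)
    (htop : Module.finrank k (Tpow k V n ⧸ Isub k V R q n) = 1)
    (hvan : Isub k V R q (n + 1) = ⊤) :
    ∀ p r : ℕ, p + r = n → ∀ a : Tpow k V p, a ∉ Isub k V R q p →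
      (∃ t : Tpow k V r, mulT k V p r (a ⊗ₜ[k] t) ∉ Isub k V R q (p + r)) ∧
      (∃ t : Tpow k V r, mulT k V r p (t ⊗ₜ[k] a) ∉ Isub k V R q (r + p)) := by
  obtain ⟨hs, hb⟩ := braid_sub q R hbraid hhecke
  obtain ⟨f, y0, hy0, hf⟩ := exists_functional _ htop
  have hy0n : y0 ∉ Isub k V R q n := fun h => by
    rw [← hf, hy0] at h; exact one_ne_zero h
  intro p r hpr a ha
  -- degree zero
  by_cases hp : p = 0
  · subst hp
    obtain rfl : r = n := by omega
    have ha0 : (show k from a) ≠ 0 := fun h => ha (by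
      have : a = 0 := h
      rw [this]; exact Submodule.zero_mem _)
    have key : (show k from a) • y0 ∉ Isub k V R q r := fun h =>
      hy0n ((Submodule.smul_mem_iff _ ha0).1 h)
    rcases hn with rfl | rfl
    · exact ⟨⟨y0, key⟩, ⟨y0, key⟩⟩
    · exact ⟨⟨y0, key⟩, ⟨y0, key⟩⟩
  by_cases hr : r = 0
  · subst hr
    obtain rfl : p = n := by omega
    have key : (1 : k) • a ∉ Isub k V R q p := by rwa [one_smul]
    rcases hn with rfl | rfl
    · exact ⟨⟨(1 : k), key⟩, ⟨(1 : k), key⟩⟩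
    · exact ⟨⟨(1 : k), key⟩, ⟨(1 : k), key⟩⟩
  rcases hn with rfl | rfl
  · obtain rfl : p = 1 := by omega
    obtain rfl : r = 1 := by omega
    obtain ⟨hL, hR⟩ := main2 q hq (R - q • LinearMap.id) hb f y0 hy0
      (fun y => (hf y).trans (Isub2 R q y))
      (fun x => (Isub3 R q x).1 (by rw [hvan]; exact Submodule.mem_top))
    have ha0 : (show V from a) ≠ 0 := fun h => ha (by
      have : a = 0 := h
      rw [this]; exact Submodule.zero_mem _)
    constructor
    · by_contra! hc
      exact ha0 (hL a fun w => (hf _).2 (hc w))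
    · by_contra! hc
      exact ha0 (hR a fun w => (hf _).2 (hc w))
  · obtain ⟨hL, hR, hX, hX'⟩ := main3 q hq (R - q • LinearMap.id) hs hb f y0 hy0
      (fun y => (hf y).trans (Isub3 R q y))
      (fun x => Isub4 R q x (by rw [hvan]; exact Submodule.mem_top))
    have m12 : ∀ (v : V) (x : V ⊗[k] V), mulT k V 1 2 ((show Tpow k V 1 from v) ⊗ₜ[k]
        (show Tpow k V 2 from x)) = (show Tpow k V 3 from (v ⊗ₜ[k] x : V ⊗[k] (V ⊗[k] V))) := by
      intro v x
      have h : mulT k V 1 2 ((show Tpow k V 1 from v) ⊗ₜ[k] (show Tpow k V 2 from x)) =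
        (show Tpow k V 3 from (LinearMap.lTensor V (LinearMap.id : V ⊗[k] V →ₗ[k] V ⊗[k] V))
          (TensorProduct.assoc k V V V ((LinearMap.rTensor V (LinearMap.id : V ⊗[k] V →ₗ[k] V ⊗[k] V))
            ((TensorProduct.assoc k V V V).symm (v ⊗ₜ[k] x))))) := rfl
      rw [h, LinearMap.lTensor_id, LinearMap.rTensor_id]
      exact (TensorProduct.assoc k V V V).apply_symm_apply (v ⊗ₜ[k] x)
    have m21 : ∀ (v : V) (x : V ⊗[k] V), mulT k V 2 1 ((show Tpow k V 2 from x) ⊗ₜ[k]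
        (show Tpow k V 1 from v)) =
        (show Tpow k V 3 from (TensorProduct.assoc k V V V (x ⊗ₜ[k] v))) := by
      intro v x
      have h : mulT k V 2 1 ((show Tpow k V 2 from x) ⊗ₜ[k] (show Tpow k V 1 from v)) =
        (show Tpow k V 3 from (LinearMap.lTensor V (LinearMap.id : V ⊗[k] V →ₗ[k] V ⊗[k] V))
          (TensorProduct.assoc k V V V (x ⊗ₜ[k] v))) := rfl
      rw [h, LinearMap.lTensor_id]
      rfl
    have memEq : ∀ {x y : Tpow k V 3}, x = y → x ∈ Isub k V R q 3 → y ∈ Isub k V R q 3 :=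
      fun e h => e ▸ h
    obtain rfl | rfl : p = 1 ∨ p = 2 := by omega
    · obtain rfl : r = 2 := by omega
      have ha0 : (show V from a) ≠ 0 := fun h => ha (by
        have : a = 0 := h
        rw [this]; exact Submodule.zero_mem _)
      constructor
      · by_contra! hc
        exact ha0 (hL a fun w => (hf _).2 (memEq (m12 a w) (hc w)))
      · by_contra! hc
        exact ha0 (hR a fun w => (hf _).2 (memEq (m21 a w) (hc w)))
    · obtain rfl : r = 1 := by omega
      constructor
      · by_contra! hc
        exact ha ((Isub2 R q a).2 (hX a fun w => (hf _).2 (memEq (m21 w a) (hc w))))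
      · by_contra! hc
        exact ha ((Isub2 R q a).2 (hX' a fun w => (hf _).2 (memEq (m12 w a) (hc w))))

end
end

section
/- Let M = H_n(q) ⊗_{H_λ} k(χ) be induced from a 1-dimensional representation χ of a parabolic subalgebra of the Hecke algebra H_n(q) (q arbitrary, possibly 0). Then the space of H_n(q)-module homomorphisms from the alternating module k_alt to M is 1-dimensional if χ is the alternating representation of H_λ (χ(T_i) = -1 for all generators T_i of H_λ), and zero otherwise. -/
noncomputable section
open Classical

variable (k : Type) [Field k] (N : ℕ)

/-- The basic transposition `τ_i = (i, i+1)` in `S_{N+1}`. -/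
def tau (i : Fin N) : Equiv.Perm (Fin (N + 1)) := Equiv.swap i.castSucc i.succ

/-- The Coxeter length of a permutation. -/
def len (σ : Equiv.Perm (Fin (N + 1))) : ℕ :=
  sInf {m | ∃ l : List (Fin N), l.length = m ∧ (l.map (tau N)).prod = σ}

/-- The Young subgroup `S_λ` generated by the basic transpositions indexed by `B`. -/
def youngSubgroup (B : Set (Fin N)) : Subgroup (Equiv.Perm (Fin (N + 1))) :=
  Subgroup.closure (tau N '' B)

/-- `σ` is a distinguished (minimal length) left coset representative of `σ S_λ`. -/
def IsDistL (B : Set (Fin N)) (σ : Equiv.Perm (Fin (N + 1))) : Prop :=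
  ∀ s ∈ youngSubgroup N B, len N σ ≤ len N (σ * s)

/-- The set `D_λ` of distinguished left coset representatives. -/
def Dset (B : Set (Fin N)) : Type := {σ : Equiv.Perm (Fin (N + 1)) // IsDistL N B σ}

/-- `χ : Fin N → k` restricted to `B` defines a one-dimensional representation of
the parabolic subalgebra `H_λ`: the values satisfy the quadratic relation and are
compatible with the braid relations. -/
def IsOneDimRep (q : k) (B : Set (Fin N)) (χ : Fin N → k) : Prop :=
  (∀ i ∈ B, (χ i - q) * (χ i + 1) = 0) ∧
  (∀ i ∈ B, ∀ j ∈ B, ((i : ℕ) + 1 = j ∨ (j : ℕ) + 1 = i) →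
    χ i * χ j * χ i = χ j * χ i * χ j)

/-- The underlying vector space of the induced module `H_n(q) ⊗_{H_λ} k(χ)`,
with standard basis `{T_σ c : σ ∈ D_λ}` indexed by distinguished coset
representatives. -/
def IndM (B : Set (Fin N)) : Type := Dset N B →₀ k

instance (B : Set (Fin N)) : AddCommGroup (IndM k N B) :=
  inferInstanceAs (AddCommGroup (Dset N B →₀ k))

instance (B : Set (Fin N)) : Module k (IndM k N B) :=
  inferInstanceAs (Module k (Dset N B →₀ k))

/-- The action of the generator `T_i` on the standard basis vector `v_σ` of the
induced module `H_n(q) ⊗_{H_λ} k(χ)`: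
`T_i v_σ = v_{τ_iσ}` if `σ ∈ A_i(λ)`;
`T_i v_σ = (q-1) v_σ + q v_{τ_iσ}` if `τ_i σ ∈ A_i(λ)`, `τ_iσ < σ`;
`T_i v_σ = χ_σ(T_i) v_σ = χ(T_j) v_σ` with `τ_j = σ⁻¹τ_iσ ∈ B_λ` if `σ ∈ B_i(λ)`. -/
def indAct (q : k) (B : Set (Fin N)) (χ : Fin N → k) (i : Fin N) (σ : Dset N B) :
    IndM k N B :=
  if h : ∃ j, j ∈ B ∧ σ.1⁻¹ * tau N i * σ.1 = tau N j then
    χ h.choose • Finsupp.single σ 1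
  else if hD : IsDistL N B (tau N i * σ.1) then
    (if len N σ.1 < len N (tau N i * σ.1) then
      Finsupp.single ⟨tau N i * σ.1, hD⟩ 1
    else
      (q - 1) • Finsupp.single σ 1 + q • Finsupp.single ⟨tau N i * σ.1, hD⟩ 1)
  else 0

/-- The operator by which the generator `T_i` acts on the induced module
`H_n(q) ⊗_{H_λ} k(χ)`. -/
def indT (q : k) (B : Set (Fin N)) (χ : Fin N → k) (i : Fin N) :
    Module.End k (IndM k N B) :=
  (Finsupp.lift (IndM k N B) k (Dset N B)) (indAct k N q B χ i)


/-! ### Combinatorics of permutations -/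

lemma perm_apply_inv {α : Type} (σ : Equiv.Perm α) (x : α) : σ (σ⁻¹ x) = x := by simp
lemma perm_inv_apply {α : Type} (σ : Equiv.Perm α) (x : α) : σ⁻¹ (σ x) = x := by simp

lemma tau_lt (i : Fin N) (x y : Fin (N + 1)) (h : x < y)
    (h2 : ¬ (x = i.castSucc ∧ y = i.succ)) : tau N i x < tau N i y := by
  unfold tau
  simp only [Equiv.swap_apply_def]
  rw [Fin.lt_def] at h
  simp only [Fin.ext_iff, Fin.val_castSucc, Fin.val_succ] at h2
  split_ifs <;> simp only [Fin.ext_iff, Fin.lt_def, Fin.val_castSucc, Fin.val_succ] at * <;> omega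

lemma tau_left (i : Fin N) : tau N i i.castSucc = i.succ := by simp [tau]
lemma tau_right (i : Fin N) : tau N i i.succ = i.castSucc := by simp [tau]
lemma tau_sq (i : Fin N) : tau N i * tau N i = 1 := by simp [tau]
lemma tau_inv (i : Fin N) : (tau N i)⁻¹ = tau N i := by simp [tau]
lemma tau_tau (i : Fin N) (x) : tau N i (tau N i x) = x := by simp [tau]

lemma tau_mul_tau_mul (i : Fin N) (σ) : tau N i * (tau N i * σ) = σ := by
  rw [← mul_assoc, tau_sq, one_mul]

lemma tau_injective : Function.Injective (tau N) := by
  intro i j h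
  by_contra hne
  have h1 := congrArg (fun f => f i.castSucc) h
  simp only [tau_left] at h1
  unfold tau at h1
  rw [Equiv.swap_apply_def] at h1
  split_ifs at h1 <;> simp_all [Fin.ext_iff] <;> omega

/-- The inversion set. -/
def invs (σ : Equiv.Perm (Fin (N + 1))) : Finset (Fin (N + 1) × Fin (N + 1)) :=
  Finset.univ.filter fun p => p.1 < p.2 ∧ σ p.2 < σ p.1

lemma mem_invs (σ : Equiv.Perm (Fin (N + 1))) (a b) :
    (a, b) ∈ invs N σ ↔ a < b ∧ σ b < σ a := by
  unfold invs
  rw [Finset.mem_filter]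
  exact and_iff_right (Finset.mem_univ _)

lemma invs_tau (i : Fin N) (σ : Equiv.Perm (Fin (N + 1)))
    (h : σ⁻¹ i.castSucc < σ⁻¹ i.succ) :
    invs N (tau N i * σ) = insert (σ⁻¹ i.castSucc, σ⁻¹ i.succ) (invs N σ) := by
  ext ⟨a, b⟩
  simp only [mem_invs, Finset.mem_insert,
    Prod.mk.injEq, Equiv.Perm.mul_apply, Equiv.Perm.eq_inv_iff_eq]
  constructor
  · rintro ⟨hab, hlt⟩
    by_cases hc : σ a = i.castSucc ∧ σ b = i.succ
    · exact Or.inl hc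
    · right
      refine ⟨hab, ?_⟩
      have := tau_lt N i _ _ hlt ?_
      · simpa [tau_tau] using this
      · rintro ⟨h1, h2⟩
        apply hc
        constructor
        · rw [← tau_tau N i (σ a), h2, tau_right]
        · rw [← tau_tau N i (σ b), h1, tau_left]
  · rintro (⟨h1, h2⟩ | ⟨hab, hlt⟩)
    · rw [h1, h2, tau_left, tau_right]
      refine ⟨?_, Fin.castSucc_lt_succ⟩
      rw [← h1, ← h2] at h
      simpa using h
    · refine ⟨hab, tau_lt N i _ _ hlt ?_⟩
      rintro ⟨h1, h2⟩
      rw [← h1, ← h2] at h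
      simp only [perm_inv_apply] at h
      exact absurd h (not_lt.2 hab.le)

lemma invs_card_up (i : Fin N) (σ : Equiv.Perm (Fin (N + 1)))
    (h : σ⁻¹ i.castSucc < σ⁻¹ i.succ) :
    (invs N (tau N i * σ)).card = (invs N σ).card + 1 := by
  rw [invs_tau N i σ h, Finset.card_insert_of_notMem]
  simp only [mem_invs, perm_apply_inv]
  rintro ⟨_, h2⟩
  exact absurd h2 (not_lt.2 Fin.castSucc_lt_succ.le)

lemma tau_mul_inv_apply (i : Fin N) (σ : Equiv.Perm (Fin (N + 1))) (x) :
    (tau N i * σ)⁻¹ x = σ⁻¹ (tau N i x) := by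
  rw [mul_inv_rev, tau_inv, Equiv.Perm.mul_apply]

lemma invs_card_down (i : Fin N) (σ : Equiv.Perm (Fin (N + 1)))
    (h : σ⁻¹ i.succ < σ⁻¹ i.castSucc) :
    (invs N (tau N i * σ)).card + 1 = (invs N σ).card := by
  have := invs_card_up N i (tau N i * σ) (by
    simpa only [tau_mul_inv_apply, tau_left, tau_right] using h)
  rw [tau_mul_tau_mul] at this
  exact this.symm

lemma ne_inv (i : Fin N) (σ : Equiv.Perm (Fin (N + 1))) :
    σ⁻¹ i.castSucc ≠ σ⁻¹ i.succ := by
  intro h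
  exact absurd (σ⁻¹.injective h) (ne_of_lt Fin.castSucc_lt_succ)

lemma invs_card_le (i : Fin N) (σ : Equiv.Perm (Fin (N + 1))) :
    (invs N (tau N i * σ)).card ≤ (invs N σ).card + 1 := by
  rcases lt_or_gt_of_ne (ne_inv N i σ) with h | h
  · exact (invs_card_up N i σ h).le
  · have := invs_card_down N i σ h
    omega

lemma invs_one : (invs N 1).card = 0 := by
  rw [Finset.card_eq_zero]
  ext ⟨a, b⟩
  simp only [mem_invs, Equiv.Perm.coe_one, id_eq,
    Finset.notMem_empty, iff_false]
  rintro ⟨h1, h2⟩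
  exact absurd h1 (not_lt.2 h2.le)

lemma invs_list (l : List (Fin N)) : (invs N ((l.map (tau N)).prod)).card ≤ l.length := by
  induction l with
  | nil => simp [invs_one]
  | cons a l ih =>
    rw [List.map_cons, List.prod_cons, List.length_cons]
    exact (invs_card_le N a _).trans (by omega)

lemma perm_eq_one_of_strictMono (σ : Equiv.Perm (Fin (N + 1))) (h : StrictMono σ) : σ = 1 := by
  have := Subsingleton.elim (h.orderIsoOfSurjective σ σ.surjective) (OrderIso.refl _)
  ext x
  have h2 := congrArg (fun f => f x) this
  simpa using congrArg Fin.val h2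

lemma exists_list (m : ℕ) : ∀ σ : Equiv.Perm (Fin (N + 1)), (invs N σ).card = m →
    ∃ l : List (Fin N), l.length = m ∧ (l.map (tau N)).prod = σ := by
  induction m with
  | zero =>
    intro σ h
    refine ⟨[], rfl, ?_⟩
    have hm : StrictMono (σ⁻¹ : Equiv.Perm (Fin (N + 1))) := by
      rw [Fin.strictMono_iff_lt_succ]
      intro i
      rcases lt_or_gt_of_ne (ne_inv N i σ) with h' | h'
      · exact h'
      · have := invs_card_down N i σ h'
        omega
    have := perm_eq_one_of_strictMono N _ hm
    simpa using (inv_eq_one.1 this).symm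
  | succ m ih =>
    intro σ h
    have : ∃ i : Fin N, σ⁻¹ i.succ < σ⁻¹ i.castSucc := by
      by_contra hno
      push Not at hno
      have hm : StrictMono (σ⁻¹ : Equiv.Perm (Fin (N + 1))) := by
        rw [Fin.strictMono_iff_lt_succ]
        intro i
        exact lt_of_le_of_ne (hno i) (ne_inv N i σ)
      have := inv_eq_one.1 (perm_eq_one_of_strictMono N _ hm)
      rw [this, invs_one] at h
      omega
    obtain ⟨i, hi⟩ := this
    have hd := invs_card_down N i σ hi
    obtain ⟨l, hl, hp⟩ := ih (tau N i * σ) (by omega)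
    refine ⟨i :: l, by simp [hl], ?_⟩
    rw [List.map_cons, List.prod_cons, hp, tau_mul_tau_mul]

lemma len_eq (σ : Equiv.Perm (Fin (N + 1))) : len N σ = (invs N σ).card := by
  apply le_antisymm
  · exact Nat.sInf_le (exists_list N _ σ rfl)
  · apply le_csInf
    · exact ⟨_, exists_list N _ σ rfl⟩
    · rintro m ⟨l, rfl, rfl⟩
      exact invs_list N l

lemma invs_inv (σ : Equiv.Perm (Fin (N + 1))) : (invs N σ⁻¹).card = (invs N σ).card := by
  apply Finset.card_bij' (fun p _ => (σ⁻¹ p.2, σ⁻¹ p.1)) (fun p _ => (σ p.2, σ p.1))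
  · rintro ⟨a, b⟩ h
    simp_all [mem_invs]
  · rintro ⟨a, b⟩ h
    simp_all [mem_invs]
  · rintro ⟨a, b⟩ h
    simp
  · rintro ⟨a, b⟩ h
    simp

/-- Being increasing along `B`. -/
def Incr (B : Set (Fin N)) (σ : Equiv.Perm (Fin (N + 1))) : Prop :=
  ∀ j ∈ B, σ j.castSucc < σ j.succ

lemma IsDistL.incr {B : Set (Fin N)} {σ : Equiv.Perm (Fin (N + 1))} (h : IsDistL N B σ) :
    Incr N B σ := by
  intro j hj
  by_contra hn
  have hlt : σ j.succ < σ j.castSucc :=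
    lt_of_le_of_ne (not_lt.1 hn) (fun e => absurd (σ.injective e).symm
      (ne_of_lt Fin.castSucc_lt_succ))
  have h1 := h (tau N j) (Subgroup.subset_closure ⟨j, hj, rfl⟩)
  rw [len_eq, len_eq, ← invs_inv N σ, ← invs_inv N (σ * _), mul_inv_rev, tau_inv] at h1
  have h2 := invs_card_down N j σ⁻¹ (by simpa using hlt)
  omega

lemma young_preserves (B : Set (Fin N)) (s) (hs : s ∈ youngSubgroup N B) (m : Fin N) (hm : m ∉ B) :
    ∀ x, s x ≤ m.castSucc ↔ x ≤ m.castSucc := by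
  induction hs using Subgroup.closure_induction with
  | mem x hx =>
    obtain ⟨j, hj, rfl⟩ := hx
    intro x
    have hne : m ≠ j := fun e => hm (e ▸ hj)
    unfold tau
    rw [Equiv.swap_apply_def]
    split_ifs <;>
      simp only [ne_eq, Fin.ext_iff, Fin.le_def, Fin.val_castSucc, Fin.val_succ] at * <;> omega
  | one => simp
  | mul x y _ _ hx hy => intro z; rw [Equiv.Perm.mul_apply, hx, hy]
  | inv x _ hx =>
    intro z
    rw [← hx, perm_apply_inv]

lemma Incr.lt_or {B : Set (Fin N)} {σ : Equiv.Perm (Fin (N + 1))} (h : Incr N B σ)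
    (a b : Fin (N + 1)) (hab : a < b) :
    σ a < σ b ∨ ∃ m : Fin N, m ∉ B ∧ a ≤ m.castSucc ∧ m.castSucc < b := by
  by_cases hc : ∃ m : Fin N, m ∉ B ∧ a ≤ m.castSucc ∧ m.castSucc < b
  · exact Or.inr hc
  left
  push Not at hc
  revert hab hc
  induction b using Fin.induction with
  | zero => intro hab; exact absurd hab (Fin.not_lt_zero a)
  | succ b ih =>
    intro hab hc
    have hle : a ≤ b.castSucc := Fin.le_castSucc_iff.2 hab
    have hb : b ∈ B := by
      by_contra hb
      exact absurd (hc b hb hle) (not_le.2 Fin.castSucc_lt_succ)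
    rcases hle.eq_or_lt with rfl | hlt
    · exact h b hb
    · exact (ih hlt (fun m hm ham => by
        by_contra hlt2
        exact absurd (hc m hm ham) (not_le.2 ((not_le.1 hlt2).trans Fin.castSucc_lt_succ)))).trans
        (h b hb)

lemma Incr.isDistL {B : Set (Fin N)} {σ : Equiv.Perm (Fin (N + 1))} (h : Incr N B σ) :
    IsDistL N B σ := by
  intro s hs
  rw [len_eq, len_eq]
  apply Finset.card_le_card_of_injOn (fun p => (s⁻¹ p.1, s⁻¹ p.2))
  · rintro ⟨a, b⟩ hab
    simp only [Finset.mem_coe, mem_invs,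
      Equiv.Perm.mul_apply, perm_apply_inv] at hab ⊢
    refine ⟨?_, hab.2⟩
    rcases h.lt_or N a b hab.1 with h1 | ⟨m, hm, h1, h2⟩
    · exact absurd h1 (not_lt.2 hab.2.le)
    · have hp := young_preserves N B s⁻¹ (inv_mem hs) m hm
      exact lt_of_le_of_lt ((hp a).2 h1) (not_le.1 fun h3 => absurd ((hp b).1 h3) (not_le.2 h2))
  · rintro ⟨a, b⟩ _ ⟨c, d⟩ _ h
    simpa using h

/-- `i` is fixed for `σ`. -/
def Fixd (B : Set (Fin N)) (i : Fin N) (σ : Equiv.Perm (Fin (N + 1))) : Prop :=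
  ∃ j, j ∈ B ∧ σ⁻¹ * tau N i * σ = tau N j

lemma conj_eq (i j : Fin N) (σ : Equiv.Perm (Fin (N + 1))) (h1 : σ j.castSucc = i.castSucc)
    (h2 : σ j.succ = i.succ) : σ⁻¹ * tau N i * σ = tau N j := by
  have : σ * tau N j * σ⁻¹ = tau N i := by
    unfold tau
    rw [← h1, ← h2, Equiv.mul_swap_eq_swap_mul, mul_assoc, mul_inv_cancel, mul_one]
  rw [← this]
  group

lemma Fixd.of_conj {B : Set (Fin N)} {i : Fin N} {σ : Equiv.Perm (Fin (N + 1))}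
    (hσ : Incr N B σ) (h : Fixd N B i σ) :
    ∃ j ∈ B, σ⁻¹ i.castSucc = j.castSucc ∧ σ⁻¹ i.succ = j.succ := by
  obtain ⟨j, hj, h⟩ := h
  refine ⟨j, hj, ?_⟩
  have hi := hσ j hj
  have e : tau N i * σ = σ * tau N j := by rw [← h]; group
  have e1 := congrArg (fun f => f j.castSucc) e
  have e2 := congrArg (fun f => f j.succ) e
  simp only [Equiv.Perm.mul_apply, tau_left, tau_right] at e1 e2
  rw [Equiv.Perm.inv_eq_iff_eq, Equiv.Perm.inv_eq_iff_eq]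
  unfold tau at e1 e2
  rw [Equiv.swap_apply_def] at e1 e2
  split_ifs at e1 e2 <;>
    simp only [Fin.ext_iff, Fin.lt_def, Fin.val_castSucc, Fin.val_succ] at * <;> omega

lemma incr_tau {B : Set (Fin N)} {i : Fin N} {σ : Equiv.Perm (Fin (N + 1))}
    (hσ : Incr N B σ) (h : ¬ Fixd N B i σ) : Incr N B (tau N i * σ) := by
  intro j hj
  rw [Equiv.Perm.mul_apply, Equiv.Perm.mul_apply]
  apply tau_lt N i _ _ (hσ j hj)
  rintro ⟨h1, h2⟩
  exact h ⟨j, hj, conj_eq N i j σ h1 h2⟩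

lemma fixd_tau {B : Set (Fin N)} {i : Fin N} {σ : Equiv.Perm (Fin (N + 1))} :
    Fixd N B i (tau N i * σ) ↔ Fixd N B i σ := by
  unfold Fixd
  have : (tau N i * σ)⁻¹ * tau N i * (tau N i * σ) = σ⁻¹ * tau N i * σ := by
    rw [mul_assoc, tau_mul_tau_mul, mul_inv_rev, tau_inv]
  rw [this]

lemma path (p : Fin (N + 1) → Fin (N + 1)) (m : Fin (N + 1)) (x y : Fin (N + 1)) (hxy : x < y)
    (hx : p x ≤ m) (hy : m < p y) : ∃ i : Fin N, p i.castSucc ≤ m ∧ m < p i.succ := by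
  revert hxy hy
  induction y using Fin.induction with
  | zero => intro h; exact absurd h (Fin.not_lt_zero x)
  | succ y ih =>
    intro hxy hy
    have hle : x ≤ y.castSucc := Fin.le_castSucc_iff.2 hxy
    by_cases hc : p y.castSucc ≤ m
    · exact ⟨y, hc, hy⟩
    · rcases hle.eq_or_lt with rfl | hlt
      · exact absurd hx hc
      · exact ih hlt (not_le.1 hc)

/-- `σ` cannot be increased inside `D`. -/
def IsTopD (B : Set (Fin N)) (σ : Equiv.Perm (Fin (N + 1))) : Prop :=
  Incr N B σ ∧ ∀ i, Fixd N B i σ ∨ σ⁻¹ i.succ < σ⁻¹ i.castSucc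

lemma IsTopD.cross {B : Set (Fin N)} {σ : Equiv.Perm (Fin (N + 1))} (h : IsTopD N B σ)
    (a b : Fin (N + 1)) (m : Fin N) (ham : a ≤ m.castSucc) (hmb : m.castSucc < b)
    (hσ : σ a < σ b) :
    m ∈ B ∧ ∃ i : Fin N, σ⁻¹ * tau N i * σ = tau N m := by
  obtain ⟨i, h1, h2⟩ := path N (σ⁻¹ : Equiv.Perm (Fin (N + 1))) m.castSucc _ _ hσ
    (by simpa using ham) (by simpa using hmb)
  rcases h.2 i with hf | hd
  · obtain ⟨j, hj, e1, e2⟩ := hf.of_conj N h.1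
    have : j = m := by
      rw [e1] at h1
      rw [e2] at h2
      simp only [Fin.le_def, Fin.lt_def, Fin.ext_iff, Fin.val_castSucc, Fin.val_succ] at *
      omega
    subst this
    refine ⟨hj, i, conj_eq N i j σ ?_ ?_⟩
    · rw [← e1, perm_apply_inv]
    · rw [← e2, perm_apply_inv]
  · exact absurd (hd.trans_le h1) (not_lt.2 h2.le)

lemma IsTopD.lt_iff {B : Set (Fin N)} {σ : Equiv.Perm (Fin (N + 1))} (h : IsTopD N B σ)
    (a b : Fin (N + 1)) (hab : a < b) :
    σ a < σ b ↔ ¬ ∃ m : Fin N, m ∉ B ∧ a ≤ m.castSucc ∧ m.castSucc < b := by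
  constructor
  · rintro hσ ⟨m, hm, h1, h2⟩
    exact hm (h.cross N a b m h1 h2 hσ).1
  · intro hn
    exact (h.1.lt_or N a b hab).resolve_right hn

lemma IsTopD.unique {B : Set (Fin N)} {σ ρ : Equiv.Perm (Fin (N + 1))} (h : IsTopD N B σ)
    (h' : IsTopD N B ρ) : σ = ρ := by
  have key : ∀ a b, a < b → (σ a < σ b ↔ ρ a < ρ b) := fun a b hab => by
    rw [h.lt_iff N a b hab, h'.lt_iff N a b hab]
  have key2 : ∀ a b, σ a < σ b → ρ a < ρ b := by
    intro a b hσ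
    rcases lt_trichotomy a b with hab | rfl | hab
    · exact (key a b hab).1 hσ
    · exact absurd hσ (lt_irrefl _)
    · by_contra hn
      have : ρ b < ρ a := lt_of_le_of_ne (not_lt.1 hn) fun e => absurd (ρ.injective e) hab.ne
      exact absurd ((key b a hab).2 this) (not_lt.2 hσ.le)
  have hm : StrictMono (ρ * σ⁻¹ : Equiv.Perm (Fin (N + 1))) := by
    intro x y hxy
    rw [Equiv.Perm.mul_apply, Equiv.Perm.mul_apply]
    apply key2
    simpa using hxy
  have := perm_eq_one_of_strictMono N _ hm
  exact (mul_inv_eq_one.1 this).symm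

lemma IsTopD.conj {B : Set (Fin N)} {σ : Equiv.Perm (Fin (N + 1))} (h : IsTopD N B σ)
    (j : Fin N) (hj : j ∈ B) : ∃ i : Fin N, σ⁻¹ * tau N i * σ = tau N j :=
  (h.cross N j.castSucc j.succ j le_rfl Fin.castSucc_lt_succ (h.1 j hj)).2

lemma exists_term (B : Set (Fin N)) : ∃ d, IsTopD N B d ∧
    ∀ σ, Incr N B σ → len N σ ≤ len N d := by
  have hne : (Finset.univ.filter fun σ => Incr N B σ).Nonempty :=
    ⟨1, Finset.mem_filter.2 ⟨Finset.mem_univ _, fun j _ => Fin.castSucc_lt_succ⟩⟩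
  obtain ⟨d, hd, hmax⟩ := Finset.exists_max_image _ (len N) hne
  simp only [Finset.mem_filter, Finset.mem_univ, true_and] at hd hmax
  refine ⟨d, ⟨hd, fun i => ?_⟩, hmax⟩
  by_contra hc
  push Not at hc
  have h1 := hmax _ (incr_tau N hd hc.1)
  rw [len_eq, len_eq, invs_card_up N i d (lt_of_le_of_ne hc.2 (ne_inv N i d))] at h1
  omega

/-! ### Linear algebra of the induced module -/

instance instFiniteDset (B : Set (Fin N)) : Finite (Dset N B) :=
  inferInstanceAs (Finite {σ : Equiv.Perm (Fin (N + 1)) // IsDistL N B σ})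

instance instFintypeDset (B : Set (Fin N)) : Fintype (Dset N B) := Fintype.ofFinite _

/-- Coordinates. -/
def co (B : Set (Fin N)) (σ : Dset N B) : IndM k N B →ₗ[k] k :=
  (Finsupp.lapply σ : (Dset N B →₀ k) →ₗ[k] k)

/-- Basis vectors. -/
def bs (B : Set (Fin N)) (σ : Dset N B) : IndM k N B :=
  (Finsupp.single σ 1 : Dset N B →₀ k)

lemma co_bs (B : Set (Fin N)) (σ ρ : Dset N B) :
    co k N B σ (bs k N B ρ) = if ρ = σ then 1 else 0 :=
  Finsupp.single_apply

lemma co_ext (B : Set (Fin N)) (v w : IndM k N B) (h : ∀ σ, co k N B σ v = co k N B σ w) :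
    v = w :=
  Finsupp.ext h

/-- Vector with given coordinates. -/
def mk (B : Set (Fin N)) (f : Dset N B → k) : IndM k N B := Finsupp.equivFunOnFinite.symm f

lemma co_mk (B : Set (Fin N)) (f : Dset N B → k) (σ) : co k N B σ (mk k N B f) = f σ := rfl

lemma indT_apply (q : k) (B : Set (Fin N)) (χ : Fin N → k) (i : Fin N) (v : IndM k N B) :
    indT k N q B χ i v = ∑ ρ, co k N B ρ v • indAct k N q B χ i ρ := by
  unfold indT
  refine (Finsupp.lift_apply (M := IndM k N B) (R := k) (X := Dset N B) _ _).trans ?_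
  exact Finsupp.sum_fintype _ _ (fun _ => zero_smul _ _)

lemma co_indT (q : k) (B : Set (Fin N)) (χ : Fin N → k) (i : Fin N) (v : IndM k N B) (σ) :
    co k N B σ (indT k N q B χ i v)
      = ∑ ρ, co k N B ρ v * co k N B σ (indAct k N q B χ i ρ) := by
  rw [indT_apply, map_sum]
  simp only [map_smul, smul_eq_mul]

lemma indAct_fixd (q : k) (B : Set (Fin N)) (χ : Fin N → k) (i j : Fin N) (σ : Dset N B)
    (hj : j ∈ B) (h : σ.1⁻¹ * tau N i * σ.1 = tau N j) :
    indAct k N q B χ i σ = χ j • bs k N B σ := by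
  have hex : ∃ j, j ∈ B ∧ σ.1⁻¹ * tau N i * σ.1 = tau N j := ⟨j, hj, h⟩
  unfold indAct
  rw [dif_pos hex]
  have : hex.choose = j := tau_injective N (hex.choose_spec.2.symm.trans h)
  rw [this]
  rfl

/-- The neighbour `τ_i σ`. -/
def nb (B : Set (Fin N)) (i : Fin N) (σ : Dset N B) (h : ¬ Fixd N B i σ.1) : Dset N B :=
  ⟨tau N i * σ.1, (incr_tau N (σ.2.incr N) h).isDistL N⟩

lemma indAct_up (q : k) (B : Set (Fin N)) (χ : Fin N → k) (i : Fin N) (σ : Dset N B)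
    (h : ¬ Fixd N B i σ.1) (hup : σ.1⁻¹ i.castSucc < σ.1⁻¹ i.succ) :
    indAct k N q B χ i σ = bs k N B (nb N B i σ h) := by
  unfold indAct
  have hl : len N σ.1 < len N (tau N i * σ.1) := by
    rw [len_eq, len_eq, invs_card_up N i σ.1 hup]
    omega
  have hne : ¬ ∃ j, j ∈ B ∧ σ.1⁻¹ * tau N i * σ.1 = tau N j := h
  have hD : IsDistL N B (tau N i * σ.1) := (nb N B i σ h).2
  rw [dif_neg hne, dif_pos hD]
  exact if_pos hl

lemma indAct_down (q : k) (B : Set (Fin N)) (χ : Fin N → k) (i : Fin N) (σ : Dset N B)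
    (h : ¬ Fixd N B i σ.1) (hup : σ.1⁻¹ i.succ < σ.1⁻¹ i.castSucc) :
    indAct k N q B χ i σ = (q - 1) • bs k N B σ + q • bs k N B (nb N B i σ h) := by
  unfold indAct
  have hl : ¬ len N σ.1 < len N (tau N i * σ.1) := by
    rw [len_eq, len_eq, ← invs_card_down N i σ.1 hup]
    omega
  have hne : ¬ ∃ j, j ∈ B ∧ σ.1⁻¹ * tau N i * σ.1 = tau N j := h
  have hD : IsDistL N B (tau N i * σ.1) := (nb N B i σ h).2
  rw [dif_neg hne, dif_pos hD]
  exact if_neg hl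

lemma nb_eq_iff (B : Set (Fin N)) (i : Fin N) (σ ρ : Dset N B) (h : ¬ Fixd N B i σ.1) :
    nb N B i σ h = ρ ↔ ρ.1 = tau N i * σ.1 := by
  constructor
  · rintro rfl; rfl
  · intro e; exact Subtype.ext e.symm

lemma co_fixd (q : k) (B : Set (Fin N)) (χ : Fin N → k) (i j : Fin N) (v : IndM k N B)
    (σ : Dset N B) (hj : j ∈ B) (h : σ.1⁻¹ * tau N i * σ.1 = tau N j) :
    co k N B σ (indT k N q B χ i v) = χ j * co k N B σ v := by
  rw [co_indT, Finset.sum_eq_single σ]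
  · rw [indAct_fixd k N q B χ i j σ hj h, map_smul, co_bs, if_pos rfl, smul_eq_mul]
    ring
  · intro ρ _ hne
    by_cases hf : Fixd N B i ρ.1
    · obtain ⟨j', hj', h'⟩ := hf
      rw [indAct_fixd k N q B χ i j' ρ hj' h', map_smul, co_bs, if_neg hne, smul_zero, mul_zero]
    · have hn : nb N B i ρ hf ≠ σ := by
        intro e
        have hs : Fixd N B i σ.1 := ⟨j, hj, h⟩
        rw [(nb_eq_iff N B i ρ σ hf).1 e, fixd_tau] at hs
        exact hf hs
      rcases lt_or_gt_of_ne (ne_inv N i ρ.1) with hu | hd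
      · rw [indAct_up k N q B χ i ρ hf hu, co_bs, if_neg hn, mul_zero]
      · rw [indAct_down k N q B χ i ρ hf hd, map_add, map_smul, map_smul, co_bs, co_bs,
          if_neg hn, if_neg hne]
        simp
  · intro hn; exact absurd (Finset.mem_univ _) hn

lemma co_nonfixd (q : k) (B : Set (Fin N)) (χ : Fin N → k) (i : Fin N) (v : IndM k N B)
    (σ : Dset N B) (h : ¬ Fixd N B i σ.1) :
    co k N B σ (indT k N q B χ i v) =
      co k N B σ v * co k N B σ (indAct k N q B χ i σ) +
      co k N B (nb N B i σ h) v * co k N B σ (indAct k N q B χ i (nb N B i σ h)) := by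
  have hne' : σ ≠ nb N B i σ h := by
    intro e
    have e1 : tau N i = 1 := by
      have := (nb_eq_iff N B i σ σ h).1 e.symm
      exact right_eq_mul.1 this
    have e2 := tau_left N i
    rw [e1] at e2
    exact absurd e2 (ne_of_lt Fin.castSucc_lt_succ)
  rw [co_indT, Finset.sum_eq_add σ (nb N B i σ h) hne']
  · intro ρ _ ⟨hne, hne2⟩
    by_cases hf : Fixd N B i ρ.1
    · obtain ⟨j', hj', h'⟩ := hf
      rw [indAct_fixd k N q B χ i j' ρ hj' h', map_smul, co_bs, if_neg hne, smul_zero, mul_zero]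
    · have hn : nb N B i ρ hf ≠ σ := by
        intro e
        apply hne2
        symm
        rw [nb_eq_iff, (nb_eq_iff N B i ρ σ hf).1 e, tau_mul_tau_mul]
      rcases lt_or_gt_of_ne (ne_inv N i ρ.1) with hu | hd
      · rw [indAct_up k N q B χ i ρ hf hu, co_bs, if_neg hn, mul_zero]
      · rw [indAct_down k N q B χ i ρ hf hd, map_add, map_smul, map_smul, co_bs, co_bs,
          if_neg hn, if_neg hne]
        simp
  · intro hn; exact absurd (Finset.mem_univ _) hn
  · intro hn; exact absurd (Finset.mem_univ _) hn

lemma nb_not_fixd (B : Set (Fin N)) (i : Fin N) (σ : Dset N B) (h : ¬ Fixd N B i σ.1) :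
    ¬ Fixd N B i (nb N B i σ h).1 := fun h' => h ((fixd_tau N).1 h')

lemma nb_nb (B : Set (Fin N)) (i : Fin N) (σ : Dset N B) (h : ¬ Fixd N B i σ.1) (h') :
    nb N B i (nb N B i σ h) h' = σ := by
  rw [nb_eq_iff]
  exact (tau_mul_tau_mul N i σ.1).symm

lemma nb_ne (B : Set (Fin N)) (i : Fin N) (σ : Dset N B) (h : ¬ Fixd N B i σ.1) :
    nb N B i σ h ≠ σ := by
  intro e
  have e1 : tau N i = 1 := right_eq_mul.1 ((nb_eq_iff N B i σ σ h).1 e)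
  have e2 := tau_left N i
  rw [e1] at e2
  exact absurd e2 (ne_of_lt Fin.castSucc_lt_succ)

lemma co_up (q : k) (B : Set (Fin N)) (χ : Fin N → k) (i : Fin N) (v : IndM k N B)
    (σ : Dset N B) (h : ¬ Fixd N B i σ.1) (hup : σ.1⁻¹ i.castSucc < σ.1⁻¹ i.succ) :
    co k N B σ (indT k N q B χ i v) = q * co k N B (nb N B i σ h) v := by
  have h' := nb_not_fixd N B i σ h
  have hd : (nb N B i σ h).1⁻¹ i.succ < (nb N B i σ h).1⁻¹ i.castSucc := by
    change (tau N i * σ.1)⁻¹ _ < (tau N i * σ.1)⁻¹ _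
    simpa only [tau_mul_inv_apply, tau_left, tau_right] using hup
  rw [co_nonfixd k N q B χ i v σ h, indAct_up k N q B χ i σ h hup,
    indAct_down k N q B χ i _ h' hd, nb_nb, map_add, map_smul, map_smul, co_bs, co_bs,
    if_neg (nb_ne N B i σ h), if_pos rfl]
  simp [mul_comm]

lemma co_down (q : k) (B : Set (Fin N)) (χ : Fin N → k) (i : Fin N) (v : IndM k N B)
    (σ : Dset N B) (h : ¬ Fixd N B i σ.1) (hd : σ.1⁻¹ i.succ < σ.1⁻¹ i.castSucc) :
    co k N B σ (indT k N q B χ i v) =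
      (q - 1) * co k N B σ v + co k N B (nb N B i σ h) v := by
  have h' := nb_not_fixd N B i σ h
  have hup : (nb N B i σ h).1⁻¹ i.castSucc < (nb N B i σ h).1⁻¹ i.succ := by
    change (tau N i * σ.1)⁻¹ _ < (tau N i * σ.1)⁻¹ _
    simpa only [tau_mul_inv_apply, tau_left, tau_right] using hd
  rw [co_nonfixd k N q B χ i v σ h, indAct_down k N q B χ i σ h hd,
    indAct_up k N q B χ i _ h' hup, nb_nb, map_add, map_smul, map_smul, co_bs, co_bs,
    if_neg (nb_ne N B i σ h), if_pos rfl]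
  simp [mul_comm]

lemma mem_iff (q : k) (B : Set (Fin N)) (χ : Fin N → k) (v : IndM k N B) :
    v ∈ (⨅ i : Fin N, LinearMap.ker (indT k N q B χ i + 1)) ↔
      ∀ i σ, co k N B σ (indT k N q B χ i v) = - co k N B σ v := by
  rw [Submodule.mem_iInf]
  refine forall_congr' fun i => ?_
  rw [LinearMap.mem_ker, LinearMap.add_apply, Module.End.one_apply]
  constructor
  · intro h σ
    rw [eq_neg_of_add_eq_zero_left h, map_neg]
  · intro h
    apply co_ext
    intro σ
    rw [map_add, h σ, map_zero, neg_add_cancel]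

lemma len_nb (B : Set (Fin N)) (i : Fin N) (σ : Dset N B) (h : ¬ Fixd N B i σ.1)
    (hup : σ.1⁻¹ i.castSucc < σ.1⁻¹ i.succ) : len N (nb N B i σ h).1 = len N σ.1 + 1 := by
  rw [len_eq, len_eq]
  exact invs_card_up N i σ.1 hup

lemma len_nb_down (B : Set (Fin N)) (i : Fin N) (σ : Dset N B) (h : ¬ Fixd N B i σ.1)
    (hd : σ.1⁻¹ i.succ < σ.1⁻¹ i.castSucc) : len N (nb N B i σ h).1 + 1 = len N σ.1 := by
  rw [len_eq, len_eq]
  exact invs_card_down N i σ.1 hd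

/-- A solution is determined by its top coordinate. -/
lemma sol_eq (q : k) (B : Set (Fin N)) (χ : Fin N → k) (v : IndM k N B)
    (hv : v ∈ (⨅ i : Fin N, LinearMap.ker (indT k N q B χ i + 1)))
    (d : Dset N B) (hd : IsTopD N B d.1) (hmax : ∀ σ, Incr N B σ → len N σ ≤ len N d.1) :
    ∀ m : ℕ, ∀ σ : Dset N B, len N d.1 - len N σ.1 = m →
      co k N B σ v = (-q) ^ m * co k N B d v := by
  rw [mem_iff] at hv
  intro m
  induction m with
  | zero =>
    intro σ hm
    have hle := hmax σ.1 (σ.2.incr N)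
    have ht : IsTopD N B σ.1 := by
      refine ⟨σ.2.incr N, fun i => ?_⟩
      by_contra hc
      push Not at hc
      have h1 := hmax _ ((nb N B i σ hc.1).2.incr N)
      rw [len_nb N B i σ hc.1 (lt_of_le_of_ne hc.2 (ne_inv N i σ.1))] at h1
      omega
    have : σ = d := Subtype.ext (ht.unique N hd)
    rw [this]; simp
  | succ m ih =>
    intro σ hm
    have : ∃ i, ¬ Fixd N B i σ.1 ∧ σ.1⁻¹ i.castSucc < σ.1⁻¹ i.succ := by
      by_contra hc
      push Not at hc
      have ht : IsTopD N B σ.1 := by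
        refine ⟨σ.2.incr N, fun i => ?_⟩
        by_cases hf : Fixd N B i σ.1
        · exact Or.inl hf
        · exact Or.inr (lt_of_le_of_ne (hc i hf) (ne_inv N i σ.1).symm)
      have : σ = d := Subtype.ext (ht.unique N hd)
      rw [this] at hm
      omega
    obtain ⟨i, hf, hup⟩ := this
    have hl := len_nb N B i σ hf hup
    have e := hv i σ
    rw [co_up k N q B χ i v σ hf hup, ih (nb N B i σ hf) (by omega)] at e
    rw [← neg_eq_iff_eq_neg] at e
    rw [← e]
    ring

/-- for the induced module `M = H_n(q) ⊗_{H_λ} k(χ)` (`q`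
arbitrary, possibly `0`), the space of `H_n(q)`-module homomorphisms
`k_alt → M` — canonically identified with the simultaneous `(-1)`-eigenspace
`{v ∈ M : T_i v = -v for all i}` — is `1`-dimensional if `χ` is the alternating
representation of `H_λ` (`χ(T_i) = -1` for all generators `T_i` of `H_λ`), and
zero otherwise. -/
theorem hom_alt_to_induced (q : k) (B : Set (Fin N))
    (χ : Fin N → k) (hχ : IsOneDimRep k N q B χ) :
    ((∀ j ∈ B, χ j = -1) →
      Module.finrank k ↥(⨅ i : Fin N, LinearMap.ker (indT k N q B χ i + 1)) = 1) ∧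
    (¬ (∀ j ∈ B, χ j = -1) →
      (⨅ i : Fin N, LinearMap.ker (indT k N q B χ i + 1)) = ⊥) := by
  obtain ⟨d0, hd, hmax⟩ := exists_term N B
  obtain ⟨d, rfl⟩ : ∃ d : Dset N B, d.1 = d0 := ⟨⟨d0, hd.1.isDistL N⟩, rfl⟩
  constructor
  · intro hall
    rw [finrank_eq_one_iff']
    have hw : mk k N B (fun σ => (-q) ^ (len N d.1 - len N σ.1)) ∈
        (⨅ i : Fin N, LinearMap.ker (indT k N q B χ i + 1)) := by
      rw [mem_iff]
      intro i σ
      by_cases hf : Fixd N B i σ.1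
      · obtain ⟨j, hj, h⟩ := hf
        rw [co_fixd k N q B χ i j _ σ hj h, hall j hj]
        ring
      · have hle := hmax _ (σ.2.incr N)
        have hle2 := hmax _ ((nb N B i σ hf).2.incr N)
        rcases lt_or_gt_of_ne (ne_inv N i σ.1) with hu | hdn
        · rw [co_up k N q B χ i _ σ hf hu, co_mk, co_mk]
          have hl := len_nb N B i σ hf hu
          have : len N d.1 - len N σ.1 = len N d.1 - len N (nb N B i σ hf).1 + 1 := by omega
          rw [this]
          ring
        · rw [co_down k N q B χ i _ σ hf hdn, co_mk, co_mk]
          have hl := len_nb_down N B i σ hf hdn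
          have : len N d.1 - len N (nb N B i σ hf).1 = len N d.1 - len N σ.1 + 1 := by omega
          rw [this]
          ring
    refine ⟨⟨_, hw⟩, ?_, ?_⟩
    · intro h0
      have h1 := congrArg (fun x => co k N B d x.1) h0
      simp [co_mk] at h1
    · rintro ⟨v, hv⟩
      refine ⟨co k N B d v, Subtype.ext (co_ext k N B _ _ fun σ => ?_)⟩
      change co k N B σ (co k N B d v • mk k N B _) = co k N B σ v
      rw [map_smul, co_mk, smul_eq_mul, sol_eq k N q B χ v hv d hd hmax _ σ rfl]
      ring
  · intro hn
    push Not at hn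
    obtain ⟨j, hj, hne⟩ := hn
    rw [eq_bot_iff]
    intro v hv
    obtain ⟨i, hi⟩ := hd.conj N j hj
    have e := (mem_iff k N q B χ v).1 hv i d
    rw [co_fixd k N q B χ i j v d hj hi] at e
    have h0 : co k N B d v = 0 := by
      have : (χ j + 1) * co k N B d v = 0 := by linear_combination e
      rcases mul_eq_zero.1 this with h | h
      · exact absurd (eq_neg_of_add_eq_zero_left h) hne
      · exact h
    rw [Submodule.mem_bot]
    apply co_ext
    intro σ
    rw [sol_eq k N q B χ v hv d hd hmax _ σ rfl, h0, mul_zero, map_zero]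

end
end
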